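/- arXiv:2506.01677 — 2 statements merged into one kernel-verified Lean document; each statement's English description precedes it below -/
import Mathlib

section
/- Let n ≥ 1, s ∈ (0,1) and 1 < p < ∞ with sp < n, and set p_s^* = np/(n − sp). There exists a constant C > 0 such that for every u ∈ C_c^∞(ℝⁿ), ‖u‖_{L^{p_s^*}(ℝⁿ)} ≤ C ( ‖u‖_{L^p(ℝⁿ)} + ‖D^s u‖_{L^p(ℝⁿ;ℝⁿ)} ). (Fractional Sobolev inequality: continuous embedding H^{s,p}(ℝⁿ) ↪ L^{p_s^*}(ℝⁿ) in the subcritical case.) -/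
open MeasureTheory Filter ENNReal

noncomputable section

/-- The normalization constant `c_{n,s}` of the Riesz fractional gradient. -/
def cns (n : ℕ) (s : ℝ) : ℝ :=
  ((n : ℝ) + s - 1) * Real.Gamma (((n : ℝ) + s - 1) / 2) /
    (Real.pi ^ ((n : ℝ) / 2) * (2 : ℝ) ^ (1 - s) * Real.Gamma ((1 - s) / 2))

/-- The Riesz fractional gradient
`D^s u (x) = c_{n,s} ∫ (u(x) - u(y))/|x-y|^{n+s} ⬝ (x-y)/|x-y| dy`. -/
def rieszGrad (n : ℕ) (s : ℝ) (u : EuclideanSpace ℝ (Fin n) → ℝ)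
    (x : EuclideanSpace ℝ (Fin n)) : EuclideanSpace ℝ (Fin n) :=
  cns n s • ∫ y, ((u x - u y) / ‖x - y‖ ^ ((n : ℝ) + s + 1)) • (x - y)

abbrev EE (n : ℕ) := EuclideanSpace ℝ (Fin n)

/-- Hardy-Littlewood maximal function (normalised by `r ^ n`). -/
def MF (n : ℕ) (f : EE n → ℝ≥0∞) (x : EE n) : ℝ≥0∞ :=
  ⨆ (r : ℝ) (_ : 0 < r), (∫⁻ y in Metric.ball x r, f y) / ENNReal.ofReal (r ^ n)

lemma lt_MF_iff (n : ℕ) (f : EE n → ℝ≥0∞) (x : EE n) (t : ℝ≥0∞) :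
    t < MF n f x ↔ ∃ r : ℝ, 0 < r ∧ t < (∫⁻ y in Metric.ball x r, f y) / ENNReal.ofReal (r ^ n) := by
  unfold MF
  simp only [lt_iSup_iff, exists_prop]

lemma le_MF (n : ℕ) (f : EE n → ℝ≥0∞) (x : EE n) {r : ℝ} (hr : 0 < r) :
    (∫⁻ y in Metric.ball x r, f y) ≤ ENNReal.ofReal (r ^ n) * MF n f x := by
  have h : (∫⁻ y in Metric.ball x r, f y) / ENNReal.ofReal (r ^ n) ≤ MF n f x := by
    unfold MF
    exact le_iSup₂ (f := fun (r : ℝ) (_ : 0 < r) =>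
      (∫⁻ y in Metric.ball x r, f y) / ENNReal.ofReal (r ^ n)) r hr
  rw [ENNReal.div_le_iff (by simp; positivity) (by simp)] at h
  rwa [mul_comm]

lemma measurable_MF (n : ℕ) (f : EE n → ℝ≥0∞) : Measurable (MF n f) := by
  apply LowerSemicontinuous.measurable
  rw [lowerSemicontinuous_iff_isOpen_preimage]
  intro t
  rw [Metric.isOpen_iff]
  intro x hx
  obtain ⟨r, hr, h⟩ := (lt_MF_iff n f x t).1 hx
  have hr' : ENNReal.ofReal (r ^ n) ≠ 0 := by simp; positivity
  -- find a slightly bigger radius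
  have hc : Tendsto (fun ρ : ℝ => (∫⁻ y in Metric.ball x r, f y) / ENNReal.ofReal (ρ ^ n))
      (nhdsWithin r (Set.Ioi r)) (nhds ((∫⁻ y in Metric.ball x r, f y) / ENNReal.ofReal (r ^ n))) := by
    apply ENNReal.Tendsto.div tendsto_const_nhds (Or.inr hr')
    · apply (ENNReal.continuous_ofReal.tendsto _).comp
      exact ((continuous_pow n).tendsto r).mono_left nhdsWithin_le_nhds
    · left; simp
  have h1 := hc.eventually (lt_mem_nhds h)
  obtain ⟨ρ, h2, h3⟩ := (h1.and self_mem_nhdsWithin).exists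
  have h3' : r < ρ := h3
  refine ⟨ρ - r, by linarith, fun y hy => ?_⟩
  refine (lt_MF_iff n f y t).2 ⟨ρ, by linarith, lt_of_lt_of_le h2 ?_⟩
  gcongr
  apply Metric.ball_subset_ball'
  rw [Metric.mem_ball, dist_comm] at hy
  linarith

lemma MF_weak (n : ℕ) (hn : 1 ≤ n) (f : EE n → ℝ≥0∞) (hf : Measurable f)
    (hfi : ∫⁻ x, f x ≠ ∞) (t : ℝ≥0∞) (ht0 : t ≠ 0) (ht : t ≠ ∞) :
    t * volume {x | t < MF n f x} ≤
      (ENNReal.ofReal (4 ^ n) * volume (Metric.ball (0 : EE n) 1)) * ∫⁻ x, f x := by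
  set S := {x | t < MF n f x} with hS
  have hch : ∀ x ∈ S, ∃ r : ℝ, 0 < r ∧
      t < (∫⁻ y in Metric.ball x r, f y) / ENNReal.ofReal (r ^ n) :=
    fun x hx => (lt_MF_iff n f x t).1 hx
  choose! r hr hlt using hch
  have hlt' : ∀ x ∈ S, t * ENNReal.ofReal (r x ^ n) ≤ ∫⁻ y in Metric.closedBall x (r x), f y := by
    intro x hx
    have h := (hlt x hx).le
    rw [ENNReal.le_div_iff_mul_le (Or.inl (by have := hr x hx; simp; positivity)) (Or.inl (by simp))] at h
    exact h.trans (lintegral_mono_set Metric.ball_subset_closedBall)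
  have hR : ∀ x ∈ S, r x ≤ max 1 ((∫⁻ x, f x) / t).toReal := by
    intro x hx
    by_cases h1 : r x ≤ 1
    · exact h1.trans (le_max_left _ _)
    · push Not at h1
      refine le_trans ?_ (le_max_right _ _)
      have h2 : ENNReal.ofReal (r x ^ n) ≤ (∫⁻ x, f x) / t := by
        rw [ENNReal.le_div_iff_mul_le (Or.inl ht0) (Or.inl ht), mul_comm]
        exact (hlt' x hx).trans (setLIntegral_le_lintegral _ _)
      have h3 := (ENNReal.ofReal_le_iff_le_toReal (ENNReal.div_ne_top hfi ht0)).1 h2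
      exact (le_self_pow₀ h1.le (by omega)).trans h3
  obtain ⟨u, hu, hdis, hcov⟩ := Vitali.exists_disjoint_subfamily_covering_enlargement_closedBall
    S (fun x => x) r _ hR 4 (by norm_num)
  have huc : u.Countable := by
    apply hdis.countable_of_nonempty_interior
    intro x hx
    rw [interior_closedBall _ (hr x (hu hx)).ne']
    exact Metric.nonempty_ball.2 (hr x (hu hx))
  have hsub : S ⊆ ⋃ b ∈ u, Metric.closedBall b (4 * r b) := by
    intro x hx
    obtain ⟨b, hb, h⟩ := hcov x hx
    exact Set.mem_biUnion hb (h (Metric.mem_closedBall_self (hr x hx).le))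
  have := huc.to_subtype
  calc t * volume S ≤ t * ∑' b : u, volume (Metric.closedBall (b : EE n) (4 * r b)) := by
        gcongr
        exact (measure_mono hsub).trans (measure_biUnion_le _ huc _)
    _ = ∑' b : u, t * volume (Metric.closedBall (b : EE n) (4 * r b)) := by
        rw [ENNReal.tsum_mul_left]
    _ ≤ ∑' b : u, (ENNReal.ofReal (4 ^ n) * volume (Metric.ball (0 : EE n) 1)) *
          ∫⁻ y in Metric.closedBall (b : EE n) (r b), f y := by
        apply ENNReal.tsum_le_tsum
        intro b
        have hb := hr b (hu b.2)
        rw [Measure.addHaar_closedBall _ _ (by positivity), finrank_euclideanSpace_fin,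
          mul_pow, ENNReal.ofReal_mul (by positivity)]
        calc _ = (ENNReal.ofReal (4 ^ n) * volume (Metric.ball (0 : EE n) 1)) *
              (t * ENNReal.ofReal (r b ^ n)) := by ring
          _ ≤ _ := by gcongr; exact hlt' b (hu b.2)
    _ = (ENNReal.ofReal (4 ^ n) * volume (Metric.ball (0 : EE n) 1)) *
          ∑' b : u, ∫⁻ y in Metric.closedBall (b : EE n) (r b), f y := by
        rw [ENNReal.tsum_mul_left]
    _ = (ENNReal.ofReal (4 ^ n) * volume (Metric.ball (0 : EE n) 1)) *
          ∫⁻ y in ⋃ b ∈ u, Metric.closedBall (b : EE n) (r b), f y := by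
        rw [lintegral_biUnion huc (fun b _ => measurableSet_closedBall) hdis]
    _ ≤ _ := by gcongr; exact Measure.restrict_le_self

lemma lint_rpow (q b : ℝ) (hq : 0 < q) (hb : 0 ≤ b) :
    ∫⁻ t in Set.Ioo 0 b, ENNReal.ofReal (t ^ (q - 1)) = ENNReal.ofReal (b ^ q / q) := by
  rw [Measure.restrict_congr_set Ioo_ae_eq_Ioc,
    ← ofReal_integral_eq_lintegral_ofReal
      ((intervalIntegrable_iff_integrableOn_Ioc_of_le hb).1
        (intervalIntegral.intervalIntegrable_rpow' (by linarith))), ← intervalIntegral.integral_of_le hb,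
    integral_rpow (Or.inl (by linarith))]
  · congr 1
    rw [show q - 1 + 1 = q by ring, Real.zero_rpow hq.ne', sub_zero]
  · filter_upwards [ae_restrict_mem measurableSet_Ioc] with y hy
    exact Real.rpow_nonneg hy.1.le _

lemma layer_le (q : ℝ) (hq : 0 < q) (a : ℝ≥0∞) :
    a ^ q ≤ ENNReal.ofReal q * ∫⁻ t in Set.Ioi (0 : ℝ), ENNReal.ofReal (t ^ (q - 1)) *
      (if ENNReal.ofReal t < a then 1 else 0) := by
  apply ENNReal.le_of_forall_nnreal_lt
  intro r hr
  have h1 : ((r ^ (1 / q) : NNReal) : ℝ≥0∞) < a := by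
    rw [ENNReal.coe_rpow_of_nonneg _ (by positivity)]
    have := ENNReal.rpow_lt_rpow hr (show 0 < 1 / q by positivity)
    rwa [← ENNReal.rpow_mul, mul_one_div_cancel hq.ne', ENNReal.rpow_one] at this
  set b : ℝ := ((r ^ (1 / q) : NNReal) : ℝ) with hb
  have hb0 : 0 ≤ b := NNReal.coe_nonneg _
  have hbr : b ^ q = r := by
    rw [hb, NNReal.coe_rpow, ← Real.rpow_mul (by positivity), one_div_mul_cancel hq.ne', Real.rpow_one]
  calc (r : ℝ≥0∞) = ENNReal.ofReal q * ENNReal.ofReal (b ^ q / q) := by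
        rw [← ENNReal.ofReal_mul hq.le, mul_div_cancel₀ _ hq.ne', hbr, ENNReal.ofReal_coe_nnreal]
    _ = ENNReal.ofReal q * ∫⁻ t in Set.Ioo 0 b, ENNReal.ofReal (t ^ (q - 1)) := by
        rw [lint_rpow q b hq hb0]
    _ = ENNReal.ofReal q * ∫⁻ t in Set.Ioo 0 b, ENNReal.ofReal (t ^ (q - 1)) *
          (if ENNReal.ofReal t < a then 1 else 0) := by
        congr 1
        apply setLIntegral_congr_fun measurableSet_Ioo
        intro t ht
        have : ENNReal.ofReal t < a := by
          refine lt_of_le_of_lt (ENNReal.ofReal_le_ofReal ht.2.le) ?_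
          rwa [hb, ENNReal.ofReal_coe_nnreal]
        simp [this]
    _ ≤ _ := by
        gcongr
        intro t ht
        exact ht.1

lemma layer_eq (q : ℝ) (hq : 0 < q) (a : ℝ≥0∞) (ha : a ≠ ∞) :
    ∫⁻ t in Set.Ioi (0 : ℝ), ENNReal.ofReal (t ^ (q - 1)) *
      (if ENNReal.ofReal t < a then 1 else 0) = ENNReal.ofReal (1 / q) * a ^ q := by
  have : ∀ t : ℝ, t ∈ Set.Ioi (0:ℝ) → ENNReal.ofReal (t ^ (q - 1)) *
      (if ENNReal.ofReal t < a then 1 else 0) = (Set.Ioo 0 a.toReal).indicator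
        (fun t => ENNReal.ofReal (t ^ (q - 1))) t := by
    intro t ht
    have ht' : 0 < t := ht
    by_cases h : ENNReal.ofReal t < a
    · have := (ENNReal.ofReal_lt_iff_lt_toReal ht'.le ha).1 h
      simp [h, this, Set.indicator, ht']
    · have : ¬ t < a.toReal := fun h' => h ((ENNReal.ofReal_lt_iff_lt_toReal ht'.le ha).2 h')
      simp only [h, this, Set.indicator, Set.mem_Ioo, and_false, if_false, mul_zero]
  rw [setLIntegral_congr_fun measurableSet_Ioi this, lintegral_indicator measurableSet_Ioo,
    Measure.restrict_restrict measurableSet_Ioo,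
    Set.inter_eq_left.2 (fun t ht => ht.1), lint_rpow q _ hq ENNReal.toReal_nonneg,
    div_eq_inv_mul, ENNReal.ofReal_mul (by positivity), one_div,
    ← ENNReal.ofReal_rpow_of_nonneg ENNReal.toReal_nonneg hq.le, ENNReal.ofReal_toReal ha]

lemma MF_level (n : ℕ) (hn : 1 ≤ n) (p : ℝ) (hp : 1 < p) (f : EE n → ℝ≥0∞) (hf : Measurable f)
    (hfi : ∫⁻ x, f x ^ p ≠ ∞) (c : ℝ) (hc : 0 < c)
    (hcv : ENNReal.ofReal c * volume (Metric.ball (0 : EE n) 1) ≤ 1 / 2) (t : ℝ) (ht : 0 < t) :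
    ENNReal.ofReal t * volume {x | ENNReal.ofReal t < MF n f x} ≤
      (2 * (ENNReal.ofReal (4 ^ n) * volume (Metric.ball (0 : EE n) 1))) *
        ∫⁻ x, f x * (if ENNReal.ofReal (c * t) < f x then 1 else 0) := by
  set g : EE n → ℝ≥0∞ := fun x => f x * (if ENNReal.ofReal (c * t) < f x then 1 else 0) with hg
  have hgm : Measurable g := by
    apply hf.mul
    exact Measurable.ite (measurableSet_lt measurable_const hf) measurable_const measurable_const
  have hct : ENNReal.ofReal (c * t) ≠ 0 := by simp; positivity
  have hgi : ∫⁻ x, g x ≠ ∞ := by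
    have hle : ∀ x, g x ≤ (ENNReal.ofReal (c * t) ^ (p - 1))⁻¹ * f x ^ p := by
      intro x
      simp only [hg]
      split_ifs with h
      · rw [mul_one, mul_comm, ← div_eq_mul_inv, ENNReal.le_div_iff_mul_le]
        · by_cases hx : f x = ∞
          · rw [hx, ENNReal.top_rpow_of_pos (by linarith)]; exact le_top
          · have h0 : f x ≠ 0 := (bot_le.trans_lt h).ne'
            rw [show f x ^ p = f x * f x ^ (p - 1) by
              conv_rhs => rw [← ENNReal.rpow_one (f x), ← ENNReal.rpow_mul, ← ENNReal.rpow_add _ _ h0 hx]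
              congr 1; ring]
            gcongr
        · left
          exact (ENNReal.rpow_pos (pos_iff_ne_zero.2 hct) (by simp)).ne'
        · left
          exact ENNReal.rpow_ne_top_of_nonneg (by linarith) (by simp)
      · simp
    refine ((lintegral_mono hle).trans_lt ?_).ne
    rw [lintegral_const_mul _ (by fun_prop)]
    refine ENNReal.mul_lt_top ?_ hfi.lt_top
    rw [ENNReal.inv_lt_top]
    exact ENNReal.rpow_pos (pos_iff_ne_zero.2 hct) (by simp)
  have hfg : ∀ x, f x ≤ g x + ENNReal.ofReal (c * t) := by
    intro x
    simp only [hg]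
    split_ifs with h
    · simp
    · simpa using h
  have hMF : ∀ x, MF n f x ≤ MF n g x + ENNReal.ofReal t / 2 := by
    intro x
    unfold MF
    apply iSup₂_le
    intro r hr
    have hrn : ENNReal.ofReal (r ^ n) ≠ 0 := by simp; positivity
    rw [ENNReal.div_le_iff hrn (by simp)]
    calc ∫⁻ y in Metric.ball x r, f y ≤ ∫⁻ y in Metric.ball x r, (g y + ENNReal.ofReal (c * t)) :=
          lintegral_mono hfg
      _ = (∫⁻ y in Metric.ball x r, g y) + ENNReal.ofReal (c * t) * volume (Metric.ball x r) := by
          rw [lintegral_add_left hgm, setLIntegral_const]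
      _ ≤ ENNReal.ofReal (r ^ n) * MF n g x + ENNReal.ofReal t / 2 * ENNReal.ofReal (r ^ n) := by
          apply add_le_add
          · exact le_MF n g x hr
          · rw [Measure.addHaar_ball_of_pos _ _ hr, finrank_euclideanSpace_fin,
              ENNReal.ofReal_mul hc.le]
            calc _ = ENNReal.ofReal t * (ENNReal.ofReal c * volume (Metric.ball (0 : EE n) 1)) *
                    ENNReal.ofReal (r ^ n) := by ring
              _ ≤ ENNReal.ofReal t * (1 / 2) * ENNReal.ofReal (r ^ n) := by gcongr
              _ = _ := by rw [mul_one_div]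
      _ = _ := by unfold MF; ring
  have hsub : {x | ENNReal.ofReal t < MF n f x} ⊆ {x | ENNReal.ofReal t / 2 < MF n g x} := by
    intro x hx
    have h1 : ENNReal.ofReal t < MF n g x + ENNReal.ofReal t / 2 := lt_of_lt_of_le hx (hMF x)
    by_contra h
    simp only [Set.mem_ofPred_eq, not_lt] at h
    have : MF n g x + ENNReal.ofReal t / 2 ≤ ENNReal.ofReal t / 2 + ENNReal.ofReal t / 2 := by gcongr
    rw [ENNReal.add_halves] at this
    exact absurd h1 (not_lt.2 this)
  have hw := MF_weak n hn g hgm hgi (ENNReal.ofReal t / 2) (by simp [ht]) (by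
    exact ENNReal.div_ne_top (by simp) (by simp))
  calc ENNReal.ofReal t * volume {x | ENNReal.ofReal t < MF n f x}
      ≤ (ENNReal.ofReal t / 2 + ENNReal.ofReal t / 2) * volume {x | ENNReal.ofReal t / 2 < MF n g x} := by
        rw [ENNReal.add_halves]; gcongr
    _ = 2 * ((ENNReal.ofReal t / 2) * volume {x | ENNReal.ofReal t / 2 < MF n g x}) := by ring
    _ ≤ _ := by rw [mul_assoc]; gcongr

lemma MF_strong (n : ℕ) (hn : 1 ≤ n) (p : ℝ) (hp : 1 < p) :
    ∃ C : ℝ≥0∞, C ≠ ∞ ∧ ∀ f : EE n → ℝ≥0∞, Measurable f → (∀ x, f x ≠ ∞) →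
      ∫⁻ x, f x ^ p ≠ ∞ → ∫⁻ x, MF n f x ^ p ≤ C * ∫⁻ x, f x ^ p := by
  set ω := volume (Metric.ball (0 : EE n) 1) with hω
  have hωt : ω ≠ ∞ := measure_ball_lt_top.ne
  obtain ⟨c, hc, hcv⟩ : ∃ c : ℝ, 0 < c ∧ ENNReal.ofReal c * ω ≤ 1 / 2 := by
    refine ⟨1 / (2 * (ω.toReal + 1)), by positivity, ?_⟩
    rw [← ENNReal.ofReal_toReal hωt, ← ENNReal.ofReal_mul (by positivity)]
    rw [show (1 / 2 : ℝ≥0∞) = ENNReal.ofReal (1 / 2) by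
      rw [ENNReal.ofReal_div_of_pos (by norm_num)]; simp]
    apply ENNReal.ofReal_le_ofReal
    have : 0 ≤ ω.toReal := ENNReal.toReal_nonneg
    rw [ENNReal.toReal_ofReal this, div_mul_eq_mul_div, div_le_div_iff₀ (by positivity) (by norm_num)]
    linarith
  set A := (2 * (ENNReal.ofReal (4 ^ n) * ω)) with hA
  refine ⟨ENNReal.ofReal p * (A * (ENNReal.ofReal (1 / (p - 1)) * ENNReal.ofReal (1 / c) ^ (p - 1))), ?_, ?_⟩
  · refine ENNReal.mul_ne_top (by simp) (ENNReal.mul_ne_top ?_ (ENNReal.mul_ne_top (by simp) ?_))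
    · exact ENNReal.mul_ne_top (by simp) (ENNReal.mul_ne_top (by simp) hωt)
    · exact ENNReal.rpow_ne_top_of_nonneg (by linarith) (by simp)
  intro f hf hft hfi
  have hMm := measurable_MF n f
  have hmeas : Measurable (fun z : EE n × ℝ => ENNReal.ofReal (z.2 ^ (p - 1)) *
      (if ENNReal.ofReal z.2 < MF n f z.1 then (1 : ℝ≥0∞) else 0)) := by
    apply Measurable.mul (by fun_prop)
    exact Measurable.ite (measurableSet_lt (by fun_prop) (by fun_prop)) measurable_const measurable_const
  have hmeas2 : Measurable (fun z : ℝ × EE n => ENNReal.ofReal (z.1 ^ (p - 1 - 1)) *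
      (f z.2 * (if ENNReal.ofReal (c * z.1) < f z.2 then (1 : ℝ≥0∞) else 0))) := by
    apply Measurable.mul (by fun_prop)
    apply Measurable.mul (by fun_prop)
    exact Measurable.ite (measurableSet_lt (by fun_prop) (by fun_prop)) measurable_const measurable_const
  calc ∫⁻ x, MF n f x ^ p
      ≤ ∫⁻ x, ENNReal.ofReal p * ∫⁻ t in Set.Ioi (0 : ℝ), ENNReal.ofReal (t ^ (p - 1)) *
      (if ENNReal.ofReal t < MF n f x then 1 else 0) := lintegral_mono fun x => layer_le p (by linarith) _
    _ = ENNReal.ofReal p * ∫⁻ x, ∫⁻ t in Set.Ioi (0 : ℝ), ENNReal.ofReal (t ^ (p - 1)) *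
      (if ENNReal.ofReal t < MF n f x then 1 else 0) := by
        rw [lintegral_const_mul]
        exact hmeas.lintegral_prod_right'
    _ = ENNReal.ofReal p * ∫⁻ t in Set.Ioi (0 : ℝ), ∫⁻ x, ENNReal.ofReal (t ^ (p - 1)) *
      (if ENNReal.ofReal t < MF n f x then 1 else 0) := by
        rw [lintegral_lintegral_swap]
        exact hmeas.aemeasurable
    _ ≤ ENNReal.ofReal p * ∫⁻ t in Set.Ioi (0 : ℝ), A * ∫⁻ x, ENNReal.ofReal (t ^ (p - 1 - 1)) *
          (f x * (if ENNReal.ofReal (c * t) < f x then 1 else 0)) := by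
        gcongr ENNReal.ofReal p * ?_
        apply setLIntegral_mono' measurableSet_Ioi
        intro t ht
        have ht' : 0 < t := ht
        have hl := MF_level n hn p hp f hf hfi c hc hcv t ht
        rw [lintegral_const_mul _ (Measurable.ite (measurableSet_lt (by fun_prop) (by fun_prop))
            measurable_const measurable_const),
          lintegral_const_mul (f := fun x => f x * (if ENNReal.ofReal (c * t) < f x then (1 : ℝ≥0∞) else 0)) _ (hf.mul (Measurable.ite (measurableSet_lt (by fun_prop) (by fun_prop))
            measurable_const measurable_const))]
        have e1 : ∫⁻ x, (if ENNReal.ofReal t < MF n f x then (1 : ℝ≥0∞) else 0) =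
            volume {x | ENNReal.ofReal t < MF n f x} := by
          rw [← lintegral_indicator_one (measurableSet_lt measurable_const hMm)]
          apply lintegral_congr
          intro x
          simp [Set.indicator]
        rw [e1]
        have e2 : ENNReal.ofReal (t ^ (p - 1)) = ENNReal.ofReal (t ^ (p - 1 - 1)) * ENNReal.ofReal t := by
          rw [← ENNReal.ofReal_mul (by positivity), ← Real.rpow_add_one ht'.ne']
          ring_nf
        rw [e2, mul_assoc]
        calc _ ≤ ENNReal.ofReal (t ^ (p - 1 - 1)) * (A * _) := by gcongr
          _ = _ := by ring
    _ = ENNReal.ofReal p * (A * ∫⁻ x, ∫⁻ t in Set.Ioi (0 : ℝ), ENNReal.ofReal (t ^ (p - 1 - 1)) *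
          (f x * (if ENNReal.ofReal (c * t) < f x then 1 else 0))) := by
        rw [lintegral_const_mul, lintegral_lintegral_swap]
        · exact hmeas2.aemeasurable
        · exact hmeas2.lintegral_prod_right'
    _ = ENNReal.ofReal p * (A * ∫⁻ x, (ENNReal.ofReal (1 / (p - 1)) * ENNReal.ofReal (1 / c) ^ (p - 1)) *
          f x ^ p) := by
        congr 2
        apply lintegral_congr
        intro x
        have hb : ENNReal.ofReal (1 / c) * f x ≠ ∞ := ENNReal.mul_ne_top (by simp) (hft x)
        have := layer_eq (p - 1) (by linarith) (ENNReal.ofReal (1 / c) * f x) hb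
        have e3 : ∀ t : ℝ, (ENNReal.ofReal (c * t) < f x ↔ ENNReal.ofReal t < ENNReal.ofReal (1 / c) * f x) := by
          intro t
          have hc0 : ENNReal.ofReal c ≠ 0 := by simp [hc]
          rw [one_div, ENNReal.ofReal_inv_of_pos hc, ← ENNReal.div_eq_inv_mul,
            ENNReal.lt_div_iff_mul_lt (Or.inl hc0) (Or.inl (by simp)), ENNReal.ofReal_mul hc.le, mul_comm]
        have e4 : ∀ t : ℝ, ENNReal.ofReal (t ^ (p - 1 - 1)) *
          (f x * (if ENNReal.ofReal (c * t) < f x then 1 else 0)) = f x * (ENNReal.ofReal (t ^ (p - 1 - 1)) *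
          ((if ENNReal.ofReal t < ENNReal.ofReal (1 / c) * f x then 1 else 0))) := by
          intro t
          simp only [e3]; ring
        simp_rw [e4]
        rw [lintegral_const_mul, this, ENNReal.mul_rpow_of_nonneg _ _ (by linarith)]
        · by_cases h0 : f x = 0
          · rw [h0, ENNReal.zero_rpow_of_pos (by linarith : 0 < p)]; simp
          · rw [show f x ^ p = f x * f x ^ (p - 1) by
              conv_rhs => rw [← ENNReal.rpow_one (f x), ← ENNReal.rpow_mul, ← ENNReal.rpow_add _ _ h0 (hft x)]
              congr 1; ring]
            ring
        · exact Measurable.mul (by fun_prop) (Measurable.ite (measurableSet_lt (by fun_prop) (by fun_prop))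
            measurable_const measurable_const)
    _ = _ := by
        rw [lintegral_const_mul _ (by fun_prop)]
        ring

lemma lint_rpow_Ioi (q b : ℝ) (hq : 0 < q) (hb : 0 < b) :
    ∫⁻ t in Set.Ioi b, ENNReal.ofReal (t ^ (-q - 1)) = ENNReal.ofReal (b ^ (-q) / q) := by
  rw [← ofReal_integral_eq_lintegral_ofReal
      (integrableOn_Ioi_rpow_of_lt (by linarith) hb), integral_Ioi_rpow_of_lt (by linarith) hb]
  · congr 1
    rw [show -q - 1 + 1 = -q by ring]
    field_simp
  · filter_upwards [ae_restrict_mem measurableSet_Ioi] with y hy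
    exact Real.rpow_nonneg (hb.trans hy).le _

/-- Riesz potential -/
def RP (n : ℕ) (s : ℝ) (f : EE n → ℝ≥0∞) (x : EE n) : ℝ≥0∞ :=
  ∫⁻ y, f y * ENNReal.ofReal (‖x - y‖ ^ (s - n))

lemma RP_le_layer (n : ℕ) (s : ℝ) (hsn : s < n) (f : EE n → ℝ≥0∞) (hf : Measurable f) (x : EE n) :
    RP n s f x ≤ ENNReal.ofReal (n - s) * ∫⁻ t in Set.Ioi (0 : ℝ), ENNReal.ofReal (t ^ (s - n - 1)) *
      ∫⁻ y in Metric.ball x t, f y := by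
  have key : ∀ y : EE n, ENNReal.ofReal (‖x - y‖ ^ (s - n)) ≤
      ENNReal.ofReal (n - s) * ∫⁻ t in Set.Ioi (0 : ℝ), ENNReal.ofReal (t ^ (s - n - 1)) *
        (if ‖x - y‖ < t then 1 else 0) := by
    intro y
    rcases (norm_nonneg (x - y)).eq_or_lt with h | h
    · rw [← h, Real.zero_rpow (by linarith)]; simp
    · have h1 := lint_rpow_Ioi (n - s) ‖x - y‖ (by linarith) h
      rw [neg_sub] at h1
      calc ENNReal.ofReal (‖x - y‖ ^ (s - n))
          = ENNReal.ofReal (n - s) * ENNReal.ofReal (‖x - y‖ ^ (s - n) / (n - s)) := by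
            rw [← ENNReal.ofReal_mul (by linarith), mul_div_cancel₀ _ (by linarith)]
        _ = ENNReal.ofReal (n - s) * ∫⁻ t in Set.Ioi ‖x - y‖, ENNReal.ofReal (t ^ (s - n - 1)) *
              (if ‖x - y‖ < t then 1 else 0) := by
            rw [← h1]
            congr 1
            apply setLIntegral_congr_fun measurableSet_Ioi
            intro t ht
            have ht' : ‖x - y‖ < t := ht
            simp [ht']
        _ ≤ _ := by
            gcongr
  have hm : Measurable (fun z : EE n × ℝ => f z.1 * (ENNReal.ofReal (z.2 ^ (s - n - 1)) *
        (if ‖x - z.1‖ < z.2 then (1 : ℝ≥0∞) else 0))) := by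
    apply Measurable.mul (by fun_prop)
    apply Measurable.mul (by fun_prop)
    exact Measurable.ite (measurableSet_lt (by fun_prop) (by fun_prop)) measurable_const measurable_const
  unfold RP
  calc _ ≤ ∫⁻ y, f y * (ENNReal.ofReal (n - s) * ∫⁻ t in Set.Ioi (0 : ℝ), ENNReal.ofReal (t ^ (s - n - 1)) *
        (if ‖x - y‖ < t then 1 else 0)) := by gcongr; exact key _
    _ = ∫⁻ y, ENNReal.ofReal (n - s) * ∫⁻ t in Set.Ioi (0 : ℝ), f y * (ENNReal.ofReal (t ^ (s - n - 1)) *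
        (if ‖x - y‖ < t then 1 else 0)) := by
        apply lintegral_congr
        intro y
        rw [lintegral_const_mul]
        · ring
        · exact Measurable.mul (by fun_prop) (Measurable.ite (measurableSet_lt (by fun_prop) (by fun_prop))
            measurable_const measurable_const)
    _ = ENNReal.ofReal (n - s) * ∫⁻ t in Set.Ioi (0 : ℝ), ∫⁻ y, f y * (ENNReal.ofReal (t ^ (s - n - 1)) *
        (if ‖x - y‖ < t then 1 else 0)) := by
        rw [lintegral_const_mul, lintegral_lintegral_swap]
        · exact hm.aemeasurable
        · exact hm.lintegral_prod_right'
    _ = _ := by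
        congr 1
        apply lintegral_congr
        intro t
        rw [← lintegral_indicator measurableSet_ball, ← lintegral_const_mul _ (hf.indicator measurableSet_ball)]
        apply lintegral_congr
        intro y
        by_cases h : ‖x - y‖ < t
        · have : y ∈ Metric.ball x t := by rwa [Metric.mem_ball, dist_comm, dist_eq_norm]
          simp [h, this, mul_comm]
        · have : y ∉ Metric.ball x t := by rwa [Metric.mem_ball, dist_comm, dist_eq_norm]
          simp [h, this]

lemma ball_holder (n : ℕ) (p : ℝ) (hp : 1 < p) (f : EE n → ℝ≥0∞) (hf : Measurable f) (x : EE n)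
    (t : ℝ) (ht : 0 < t) :
    ∫⁻ y in Metric.ball x t, f y ≤ (∫⁻ y, f y ^ p) ^ (1 / p) *
      (volume (Metric.ball (0 : EE n) 1) ^ (1 - 1 / p) * ENNReal.ofReal (t ^ (n * (1 - 1 / p)))) := by
  have hpq : p.HolderConjugate (Real.conjExponent p) := Real.HolderConjugate.conjExponent hp
  have h := ENNReal.lintegral_mul_le_Lp_mul_Lq (volume.restrict (Metric.ball x t)) hpq
    hf.aemeasurable (g := fun _ => 1) aemeasurable_const
  simp only [Pi.mul_apply, mul_one, ENNReal.one_rpow, lintegral_const, one_mul,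
    Measure.restrict_apply_univ] at h
  have hpp : 1 / Real.conjExponent p = 1 - 1 / p := by
    have := hpq.inv_add_inv_eq_one
    simp only [one_div]; linarith
  have hpp0 : 0 ≤ 1 - 1 / p := by
    have : 1 / p < 1 := by rw [div_lt_one (by linarith)]; exact hp
    linarith
  refine h.trans ?_
  rw [hpp]
  gcongr
  · exact Measure.restrict_le_self
  · rw [Measure.addHaar_ball_of_pos _ _ ht, finrank_euclideanSpace_fin,
      ENNReal.mul_rpow_of_nonneg _ _ hpp0, mul_comm, ENNReal.ofReal_rpow_of_nonneg (by positivity) hpp0,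
      ← Real.rpow_natCast, ← Real.rpow_mul ht.le]

lemma RP_split (n : ℕ) (hn : 1 ≤ n) (s p : ℝ) (hs0 : 0 < s) (hp : 1 < p) (hsp : s * p < n) :
    ∃ C : ℝ≥0∞, C ≠ ∞ ∧ ∀ f : EE n → ℝ≥0∞, Measurable f → ∀ x : EE n, ∀ δ : ℝ, 0 < δ →
      RP n s f x ≤ C * (ENNReal.ofReal (δ ^ s) * MF n f x +
        ENNReal.ofReal (δ ^ (s - n / p)) * (∫⁻ y, f y ^ p) ^ (1 / p)) := by
  have hsn : s < n := by nlinarith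
  have hsp' : 0 < n / p - s := by
    rw [sub_pos, lt_div_iff₀ (by linarith)]; exact hsp
  set ω := volume (Metric.ball (0 : EE n) 1) with hω
  have hωt : ω ≠ ∞ := measure_ball_lt_top.ne
  have hpp0 : 0 ≤ 1 - 1 / p := by
    have : 1 / p < 1 := by rw [div_lt_one (by linarith)]; exact hp
    linarith
  refine ⟨ENNReal.ofReal (n - s) * (ENNReal.ofReal (1 / s) + ENNReal.ofReal (1 / (n / p - s)) * ω ^ (1 - 1 / p)), ?_, ?_⟩
  · refine ENNReal.mul_ne_top (by simp) (ENNReal.add_ne_top.2 ⟨by simp, ENNReal.mul_ne_top (by simp) ?_⟩)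
    exact ENNReal.rpow_ne_top_of_nonneg hpp0 hωt
  intro f hf x δ hδ
  refine (RP_le_layer n s hsn f hf x).trans ?_
  rw [mul_assoc]
  gcongr ENNReal.ofReal (n - s) * ?_
  set N := (∫⁻ y, f y ^ p) ^ (1 / p) with hN
  set M := MF n f x with hM
  have h1 : ∫⁻ t in Set.Ioo 0 δ, ENNReal.ofReal (t ^ (s - n - 1)) * ∫⁻ y in Metric.ball x t, f y
      ≤ ENNReal.ofReal (1 / s) * (ENNReal.ofReal (δ ^ s) * M) := by
    calc _ ≤ ∫⁻ t in Set.Ioo 0 δ, ENNReal.ofReal (t ^ (s - 1)) * M := by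
          apply setLIntegral_mono' measurableSet_Ioo
          intro t ht
          have ht0 : 0 < t := ht.1
          calc _ ≤ ENNReal.ofReal (t ^ (s - n - 1)) * (ENNReal.ofReal (t ^ n) * M) := by
                gcongr; exact le_MF n f x ht0
            _ = _ := by
                rw [← mul_assoc, ← ENNReal.ofReal_mul (by positivity), ← Real.rpow_natCast, ← Real.rpow_add ht0]
                congr 3; ring
      _ = _ := by
          rw [lintegral_mul_const _ (by fun_prop), lint_rpow s δ hs0 hδ.le, ← mul_assoc,
            ← ENNReal.ofReal_mul (by positivity)]
          congr 2; ring
  have h2 : ∫⁻ t in Set.Ici δ, ENNReal.ofReal (t ^ (s - n - 1)) * ∫⁻ y in Metric.ball x t, f y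
      ≤ (ENNReal.ofReal (1 / (n / p - s)) * ω ^ (1 - 1 / p)) * (ENNReal.ofReal (δ ^ (s - n / p)) * N) := by
    rw [Measure.restrict_congr_set Ioi_ae_eq_Ici.symm]
    calc _ ≤ ∫⁻ t in Set.Ioi δ, ENNReal.ofReal (t ^ (-(n / p - s) - 1)) * (N * ω ^ (1 - 1 / p)) := by
          apply setLIntegral_mono' measurableSet_Ioi
          intro t ht
          have ht0 : 0 < t := hδ.trans ht
          calc _ ≤ ENNReal.ofReal (t ^ (s - n - 1)) *
                  (N * (ω ^ (1 - 1 / p) * ENNReal.ofReal (t ^ (n * (1 - 1 / p))))) := by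
                gcongr; exact ball_holder n p hp f hf x t ht0
            _ = (ENNReal.ofReal (t ^ (s - n - 1)) * ENNReal.ofReal (t ^ (n * (1 - 1 / p)))) * (N * ω ^ (1 - 1 / p)) := by
                ring
            _ = _ := by
                rw [← ENNReal.ofReal_mul (by positivity), ← Real.rpow_add ht0]
                congr 3; ring
      _ = _ := by
          rw [lintegral_mul_const _ (by fun_prop), lint_rpow_Ioi _ δ hsp' hδ, neg_sub, div_eq_mul_one_div,
            ENNReal.ofReal_mul (by positivity)]
          ring
  have hu : Set.Ioi (0 : ℝ) = Set.Ioo 0 δ ∪ Set.Ici δ := (Set.Ioo_union_Ici_eq_Ioi hδ).symm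
  rw [hu]
  refine (lintegral_union_le _ _ _).trans ((add_le_add h1 h2).trans ?_)
  rw [add_mul]
  gcongr
  · exact le_self_add
  · exact le_add_self

lemma RP_hedberg (n : ℕ) (hn : 1 ≤ n) (s p : ℝ) (hs0 : 0 < s) (hp : 1 < p) (hsp : s * p < n) :
    ∃ C : ℝ≥0∞, C ≠ ∞ ∧ ∀ f : EE n → ℝ≥0∞, Measurable f →
      (∫⁻ y, f y ^ p) ≠ 0 → (∫⁻ y, f y ^ p) ≠ ∞ → ∀ x : EE n,
      RP n s f x ≤ C * (((∫⁻ y, f y ^ p) ^ (1 / p)) ^ (s * p / n) * MF n f x ^ (1 - s * p / n)) := by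
  have hsn : s < n := by nlinarith
  have hn0 : (0 : ℝ) < n := by exact_mod_cast hn
  have hth1 : s * p / n < 1 := by rw [div_lt_one hn0]; exact hsp
  have hth0 : 0 < s * p / n := by positivity
  obtain ⟨C, hC, h⟩ := RP_split n hn s p hs0 hp hsp
  refine ⟨C * 2, ENNReal.mul_ne_top hC (by simp), ?_⟩
  intro f hf hf0 hft x
  set N := (∫⁻ y, f y ^ p) ^ (1 / p) with hN
  have hp0 : 0 < 1 / p := by positivity
  have hN0 : N ≠ 0 := by
    exact (ENNReal.rpow_pos (pos_iff_ne_zero.2 hf0) hft).ne'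
  have hNt : N ≠ ∞ := ENNReal.rpow_ne_top_of_nonneg hp0.le hft
  by_cases hM0 : MF n f x = 0
  · have : RP n s f x = 0 := by
      refine le_antisymm ?_ (bot_le)
      refine (RP_le_layer n s hsn f hf x).trans ?_
      have : ∫⁻ t in Set.Ioi (0 : ℝ), ENNReal.ofReal (t ^ (s - n - 1)) * ∫⁻ y in Metric.ball x t, f y
          = ∫⁻ t in Set.Ioi (0 : ℝ), 0 := by
        apply setLIntegral_congr_fun measurableSet_Ioi
        intro t ht
        have := le_MF n f x ht
        rw [hM0, mul_zero] at this
        simp [le_antisymm this (bot_le)]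
      rw [this]; simp
    rw [this]; exact bot_le
  by_cases hMt : MF n f x = ∞
  · have hCpos : C * 2 ≠ 0 ∨ RP n s f x = 0 := by
      by_cases hC0 : C = 0
      · right
        have := h f hf x 1 one_pos
        rw [hC0, zero_mul] at this
        exact le_antisymm this (bot_le)
      · left; simp [hC0]
    rcases hCpos with h0 | h0
    · rw [hMt, ENNReal.top_rpow_of_pos (by linarith), ENNReal.mul_top, ENNReal.mul_top h0]
      · exact le_top
      · exact (ENNReal.rpow_pos (pos_iff_ne_zero.2 hN0) hNt).ne'
    · rw [h0]; exact bot_le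
  set M := MF n f x with hM
  obtain ⟨a, ha⟩ : ∃ a : ℝ, a = N.toReal := ⟨_, rfl⟩
  obtain ⟨b, hb⟩ : ∃ b : ℝ, b = M.toReal := ⟨_, rfl⟩
  have ha0 : 0 < a := ha ▸ ENNReal.toReal_pos hN0 hNt
  have hb0 : 0 < b := hb ▸ ENNReal.toReal_pos hM0 hMt
  have hNa : N = ENNReal.ofReal a := by rw [ha, ENNReal.ofReal_toReal hNt]
  have hMb : M = ENNReal.ofReal b := by rw [hb, ENNReal.ofReal_toReal hMt]
  have h1 := h f hf x ((a / b) ^ (p / n)) (by positivity)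
  refine h1.trans ?_
  rw [← hN, ← hM, mul_assoc C 2]
  gcongr C * ?_
  rw [hNa, hMb, ENNReal.ofReal_rpow_of_pos ha0, ENNReal.ofReal_rpow_of_pos hb0,
    ← ENNReal.ofReal_mul (by positivity), ← ENNReal.ofReal_mul (by positivity), ← ENNReal.ofReal_mul (by positivity),
    two_mul]
  have e1 : ((a / b) ^ (p / n)) ^ s * b = a ^ (s * p / n) * b ^ (1 - s * p / n) := by
    rw [← Real.rpow_mul (by positivity), Real.div_rpow ha0.le hb0.le, Real.rpow_sub hb0, Real.rpow_one]
    rw [show p / n * s = s * p / n by ring]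
    field_simp
  have e2 : ((a / b) ^ (p / n)) ^ (s - n / p) * a = a ^ (s * p / n) * b ^ (1 - s * p / n) := by
    rw [← Real.rpow_mul (by positivity), show p / n * (s - n / p) = s * p / n - 1 by field_simp,
      Real.rpow_sub (by positivity), Real.div_rpow ha0.le hb0.le, Real.rpow_sub hb0, Real.rpow_one, Real.rpow_one]
    field_simp
  rw [e1, e2]

lemma HLS (n : ℕ) (hn : 1 ≤ n) (s p : ℝ) (hs0 : 0 < s) (hp : 1 < p) (hsp : s * p < n) :
    ∃ C : ℝ≥0∞, C ≠ ∞ ∧ ∀ f : EE n → ℝ≥0∞, Measurable f → (∀ x, f x ≠ ∞) → ∫⁻ y, f y ^ p ≠ ∞ →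
      (∫⁻ x, RP n s f x ^ (n * p / (n - s * p))) ^ (1 / (n * p / (n - s * p))) ≤
        C * (∫⁻ y, f y ^ p) ^ (1 / p) := by
  have hn0 : (0 : ℝ) < n := by exact_mod_cast hn
  have hth1 : s * p / n < 1 := by rw [div_lt_one hn0]; exact hsp
  have hth0 : 0 < s * p / n := by positivity
  set q := n * p / (n - s * p) with hq
  have hsp' : 0 < n - s * p := by linarith
  have hq0 : 0 < q := by positivity
  obtain ⟨C, hC, h⟩ := RP_hedberg n hn s p hs0 hp hsp
  obtain ⟨D, hD, hM⟩ := MF_strong n hn p hp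
  refine ⟨C * D ^ (1 / q), ENNReal.mul_ne_top hC (ENNReal.rpow_ne_top_of_nonneg (by positivity) hD), ?_⟩
  intro f hf hft hfi
  by_cases hf0 : ∫⁻ y, f y ^ p = 0
  · have hae : f =ᵐ[volume] 0 := by
      rw [lintegral_eq_zero_iff (by fun_prop)] at hf0
      filter_upwards [hf0] with x hx
      simpa [ENNReal.rpow_eq_zero_iff, hft x, show 0 < p by linarith] using hx
    have : ∀ x, RP n s f x = 0 := by
      intro x
      unfold RP
      rw [← lintegral_zero (μ := (volume : Measure (EE n)))]
      apply lintegral_congr_ae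
      filter_upwards [hae] with y hy
      simp [hy]
    simp only [this, ENNReal.zero_rpow_of_pos hq0, lintegral_zero]
    rw [ENNReal.zero_rpow_of_pos (by positivity)]
    exact bot_le
  set A := ∫⁻ y, f y ^ p with hA
  have hN0 : A ^ (1 / p) ≠ 0 := (ENNReal.rpow_pos (pos_iff_ne_zero.2 hf0) hfi).ne'
  have hNt : A ^ (1 / p) ≠ ∞ := ENNReal.rpow_ne_top_of_nonneg (by positivity) hfi
  have hIntg : ∫⁻ x, RP n s f x ^ q ≤ (C * D ^ (1 / q) * A ^ (1 / p)) ^ q := by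
    calc ∫⁻ x, RP n s f x ^ q ≤ ∫⁻ x, (C * ((A ^ (1 / p)) ^ (s * p / n) * MF n f x ^ (1 - s * p / n))) ^ q := by
          gcongr; exact h f hf hf0 hfi _
      _ = ∫⁻ x, (C ^ q * (A ^ (1 / p)) ^ (q - p)) * MF n f x ^ p := by
          apply lintegral_congr
          intro x
          rw [ENNReal.mul_rpow_of_nonneg _ _ hq0.le, ENNReal.mul_rpow_of_nonneg _ _ hq0.le,
            ← ENNReal.rpow_mul _ (s * p / n), ← ENNReal.rpow_mul _ (1 - s * p / n), mul_assoc]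
          have e1 : (1 - s * p / n) * q = p := by rw [hq]; field_simp
          have e2 : s * p / n * q = q - p := by linarith
          rw [e1, e2]
      _ = (C ^ q * (A ^ (1 / p)) ^ (q - p)) * ∫⁻ x, MF n f x ^ p := by
          rw [lintegral_const_mul _ ((measurable_MF n f).pow_const _)]
      _ ≤ (C ^ q * (A ^ (1 / p)) ^ (q - p)) * (D * A) := by
          gcongr; exact hM f hf hft hfi
      _ = (C * D ^ (1 / q) * A ^ (1 / p)) ^ q := by
          have e3 : A = (A ^ (1 / p)) ^ p := by
            rw [← ENNReal.rpow_mul, one_div_mul_cancel (by linarith), ENNReal.rpow_one]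
          rw [ENNReal.mul_rpow_of_nonneg _ _ hq0.le, ENNReal.mul_rpow_of_nonneg _ _ hq0.le, ← ENNReal.rpow_mul D,
            one_div_mul_cancel hq0.ne', ENNReal.rpow_one]
          nth_rewrite 2 [e3]
          calc _ = C ^ q * D * ((A ^ (1 / p)) ^ (q - p) * (A ^ (1 / p)) ^ p) := by ring
            _ = _ := by rw [← ENNReal.rpow_add _ _ hN0 hNt]; congr 2; ring
  calc _ ≤ ((C * D ^ (1 / q) * A ^ (1 / p)) ^ q) ^ (1 / q) := by gcongr
    _ = _ := by rw [← ENNReal.rpow_mul, mul_one_div_cancel hq0.ne', ENNReal.rpow_one]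

lemma EE_nontrivial (n : ℕ) (hn : 1 ≤ n) : Nontrivial (EE n) := by
  have : Nonempty (Fin n) := ⟨⟨0, hn⟩⟩
  infer_instance

lemma int_ball (n : ℕ) (hn : 1 ≤ n) (b R : ℝ) (hb : b < n) :
    IntegrableOn (fun w : EE n => ‖w‖ ^ (-b)) (Metric.ball 0 R) := by
  have := EE_nontrivial n hn
  rw [integrableOn_fun_norm_addHaar volume (f := fun t => t ^ (-b))]
  rw [finrank_euclideanSpace_fin]
  have h : IntegrableOn (fun t : ℝ => t ^ ((n : ℝ) - 1 - b)) (Set.Ioo 0 R) := by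
    rcases le_or_gt R 0 with hR | hR
    · rw [Set.Ioo_eq_empty (by linarith)]; simp
    · refine IntegrableOn.mono_set ?_ (Set.Ioo_subset_Ioc_self)
      exact (intervalIntegrable_iff_integrableOn_Ioc_of_le hR.le).1
        (intervalIntegral.intervalIntegrable_rpow' (by linarith))
  refine h.congr_fun ?_ measurableSet_Ioo
  intro t ht
  have ht0 : 0 < t := ht.1
  simp only [smul_eq_mul]
  rw [← Real.rpow_natCast, ← Real.rpow_add ht0, Nat.cast_sub hn]
  congr 1; push_cast; ring

lemma int_compl (n : ℕ) (hn : 1 ≤ n) (b R : ℝ) (hR : 0 < R) (hb : n < b) :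
    IntegrableOn (fun w : EE n => ‖w‖ ^ (-b)) (Metric.ball 0 R)ᶜ := by
  have := EE_nontrivial n hn
  rw [← integrable_indicator_iff measurableSet_ball.compl]
  have h1 : Integrable (fun w : EE n => (Set.Ici R).indicator (fun t : ℝ => t ^ (-b)) ‖w‖) := by
    rw [integrable_fun_norm_addHaar volume (f := (Set.Ici R).indicator (fun t : ℝ => t ^ (-b))),
      finrank_euclideanSpace_fin]
    have h : IntegrableOn (fun t : ℝ => t ^ ((n : ℝ) - 1 - b)) (Set.Ici R) := by
      rw [integrableOn_Ici_iff_integrableOn_Ioi]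
      exact integrableOn_Ioi_rpow_of_lt (by linarith) hR
    have h2 : Integrable ((Set.Ici R).indicator (fun t : ℝ => t ^ ((n : ℝ) - 1 - b))) :=
      (integrable_indicator_iff measurableSet_Ici).2 h
    refine (h2.integrableOn (s := Set.Ioi 0)).congr_fun ?_ measurableSet_Ioi
    intro t ht
    have ht0 : 0 < t := ht
    by_cases h3 : t ∈ Set.Ici R
    · simp only [h3, Set.indicator_of_mem, smul_eq_mul]
      rw [← Real.rpow_natCast, ← Real.rpow_add ht0, Nat.cast_sub hn]
      congr 1; push_cast; ring
    · simp [h3]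
  refine h1.congr (Eventually.of_forall fun w => ?_)
  simp [Set.indicator]

/-- If `|F w| ≤ A` and `|F w| ≤ L ‖w‖`, then `F w ‖w‖^(-(n+s))` is integrable. -/
lemma int_diff (n : ℕ) (hn : 1 ≤ n) (s : ℝ) (hs0 : 0 < s) (hs1 : s < 1) (F : EE n → ℝ)
    (hF : Continuous F) (A L : ℝ) (hA : ∀ w, |F w| ≤ A) (hL : ∀ w, |F w| ≤ L * ‖w‖) :
    Integrable (fun w => F w * ‖w‖ ^ (-((n : ℝ) + s))) := by
  have hm : AEStronglyMeasurable (fun w : EE n => F w * ‖w‖ ^ (-((n : ℝ) + s))) volume := by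
    apply Measurable.aestronglyMeasurable
    have := hF.measurable
    fun_prop
  rw [← integrableOn_univ, ← Set.union_compl_self (Metric.ball (0 : EE n) 1)]
  refine IntegrableOn.union ?_ ?_
  · refine Integrable.mono' ((int_ball n hn (n + s - 1) 1 (by linarith)).const_mul L) hm.restrict ?_
    refine Eventually.of_forall fun w => ?_
    rw [norm_mul, Real.norm_eq_abs, Real.norm_of_nonneg (by positivity)]
    rcases (norm_nonneg w).eq_or_lt with h | h
    · rw [← h, Real.zero_rpow (by have : (0:ℝ) ≤ n := by positivity
                                  linarith), mul_zero]
      have hL0 : 0 ≤ L := by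
        have := EE_nontrivial n hn
        obtain ⟨v, hv⟩ := exists_ne (0 : EE n)
        have := (abs_nonneg _).trans (hL v)
        exact nonneg_of_mul_nonneg_left this (norm_pos_iff.2 hv)
      exact mul_nonneg hL0 (Real.rpow_nonneg le_rfl _)
    · calc _ ≤ L * ‖w‖ * ‖w‖ ^ (-((n : ℝ) + s)) := by gcongr; exact hL w
        _ = _ := by
          rw [mul_assoc]
          congr 1
          nth_rewrite 1 [← Real.rpow_one ‖w‖]
          rw [← Real.rpow_add h]; congr 1; ring
  · refine Integrable.mono' ((int_compl n hn (n + s) 1 one_pos (by linarith)).const_mul A) hm.restrict ?_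
    refine Eventually.of_forall fun w => ?_
    rw [norm_mul, Real.norm_eq_abs, Real.norm_of_nonneg (by positivity)]
    gcongr; exact hA w

lemma int_cpt (n : ℕ) (hn : 1 ≤ n) (b : ℝ) (hb : b < n) (G : EE n → ℝ) (hG : Continuous G)
    (hGc : HasCompactSupport G) : Integrable (fun w => G w * ‖w‖ ^ (-b)) := by
  obtain ⟨A, hA⟩ := hG.bounded_above_of_compact_support hGc
  obtain ⟨R, hR⟩ := hGc.isCompact.isBounded.subset_ball (0 : EE n)
  have hm : AEStronglyMeasurable (fun w : EE n => G w * ‖w‖ ^ (-b)) volume := by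
    apply Measurable.aestronglyMeasurable
    have := hG.measurable
    fun_prop
  have : IntegrableOn (fun w => G w * ‖w‖ ^ (-b)) (Metric.ball 0 R) := by
    refine Integrable.mono' ((int_ball n hn b R hb).const_mul A) hm.restrict ?_
    refine Eventually.of_forall fun w => ?_
    rw [norm_mul, Real.norm_of_nonneg (by positivity : 0 ≤ ‖w‖ ^ (-b))]
    gcongr; exact hA w
  rw [integrableOn_iff_integrable_of_support_subset] at this
  · exact this
  · intro w hw
    apply hR
    apply subset_tsupport
    intro h0
    apply hw
    simp [h0]

/-- regularised kernel -/
def Neps (n : ℕ) (a δ : ℝ) (w : EE n) : ℝ := (δ + ‖w‖ ^ 2) ^ (-a / 2)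

lemma Neps_hasFDerivAt (n : ℕ) (a δ : ℝ) (hδ : 0 < δ) (w : EE n) :
    HasFDerivAt (Neps n a δ) ((-a * (δ + ‖w‖ ^ 2) ^ (-a / 2 - 1)) • (innerSL ℝ w)) w := by
  have h1 : HasFDerivAt (fun w : EE n => δ + ‖w‖ ^ 2) (2 • (innerSL ℝ w)) w :=
    ((hasStrictFDerivAt_norm_sq w).hasFDerivAt).const_add δ
  have h2 := h1.rpow_const (p := -a / 2) (Or.inl (by positivity))
  unfold Neps
  have e : (-a * (δ + ‖w‖ ^ 2) ^ (-a / 2 - 1)) • (innerSL ℝ w) =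
      (-a / 2 * (δ + ‖w‖ ^ 2) ^ (-a / 2 - 1)) • 2 • (innerSL ℝ) w := by
    rw [← Nat.cast_smul_eq_nsmul ℝ, smul_smul]
    congr 1; push_cast; ring
  rw [e]
  exact h2

lemma Neps_cont (n : ℕ) (b δ : ℝ) (hδ : 0 < δ) :
    Continuous (fun w : EE n => (δ + ‖w‖ ^ 2) ^ b) := by
  apply Continuous.rpow_const (by fun_prop)
  intro w; left; positivity

lemma ibp_eps (n : ℕ) (a δ : ℝ) (hδ : 0 < δ) (u : EE n → ℝ)
    (hu : ContDiff ℝ (⊤ : ℕ∞) u) (huc : HasCompactSupport u) (x h : EE n)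
    (hi : Integrable (fun w => (u x - u (x - w)) * (a * (δ + ‖w‖ ^ 2) ^ (-a / 2 - 1) * inner ℝ w h))) :
    ∫ w, (u x - u (x - w)) * (a * (δ + ‖w‖ ^ 2) ^ (-a / 2 - 1) * inner ℝ w h) =
      ∫ w, fderiv ℝ u (x - w) h * (δ + ‖w‖ ^ 2) ^ (-a / 2) := by
  set v : EE n → ℝ := fun w => u (x - w) with hv
  have hvd : ContDiff ℝ (⊤ : ℕ∞) v := hu.comp (contDiff_const.sub contDiff_id)
  have hvc : HasCompactSupport v := by
    have := huc.comp_homeomorph (Homeomorph.subLeft x)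
    exact this
  have hfd : ∀ w, fderiv ℝ v w h = - fderiv ℝ u (x - w) h := by
    intro w
    have h1 : HasFDerivAt u (fderiv ℝ u (x - w)) (x - w) :=
      (hu.differentiable (by simp) _).hasFDerivAt
    have h2 : HasFDerivAt (fun w : EE n => x - w) (-(ContinuousLinearMap.id ℝ (EE n))) w :=
      (hasFDerivAt_id w).const_sub x
    have h3 := (h1.comp w h2).fderiv
    have h4 : fderiv ℝ v w = (fderiv ℝ u (x - w)).comp (-(ContinuousLinearMap.id ℝ (EE n))) := h3
    rw [h4]; simp
  have hG : ∀ w, fderiv ℝ (Neps n a δ) w h = - (a * (δ + ‖w‖ ^ 2) ^ (-a / 2 - 1) * inner ℝ w h) := by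
    intro w
    rw [(Neps_hasFDerivAt n a δ hδ w).fderiv]
    simp
  have hGc : Continuous (fun w : EE n => a * (δ + ‖w‖ ^ 2) ^ (-a / 2 - 1) * inner ℝ w h) :=
    (continuous_const.mul (Neps_cont n _ δ hδ)).mul (by fun_prop)
  have hNc : Continuous (Neps n a δ) := Neps_cont n _ δ hδ
  have hi2 : Integrable (fun w => v w * (a * (δ + ‖w‖ ^ 2) ^ (-a / 2 - 1) * inner ℝ w h)) :=
    (hvd.continuous.mul hGc).integrable_of_hasCompactSupport hvc.mul_right
  have hfc : Continuous (fun w => fderiv ℝ v w h) :=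
    (hvd.continuous_fderiv (by simp)).clm_apply continuous_const
  have hfcs : HasCompactSupport (fun w => fderiv ℝ v w h) := hvc.fderiv_apply ℝ h
  have hparts := integral_mul_fderiv_eq_neg_fderiv_mul_of_integrable (μ := (volume : Measure (EE n)))
    (f := v) (g := Neps n a δ) (v := h)
    ((hfc.mul hNc).integrable_of_hasCompactSupport hfcs.mul_right)
    (by
      simp_rw [hG]
      simpa using hi2.neg)
    ((hvd.continuous.mul hNc).integrable_of_hasCompactSupport hvc.mul_right)
    (fun w _ => hvd.differentiable (by simp) w)
    (fun w _ => (Neps_hasFDerivAt n a δ hδ w).differentiableAt)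
  simp_rw [hG, hfd] at hparts
  simp only [mul_neg, neg_mul, integral_neg, neg_neg] at hparts
  have hodd : ∫ w : EE n, u x * (a * (δ + ‖w‖ ^ 2) ^ (-a / 2 - 1) * inner ℝ w h) = 0 := by
    have h1 := integral_neg_eq_self (fun w : EE n => u x * (a * (δ + ‖w‖ ^ 2) ^ (-a / 2 - 1) * inner ℝ w h)) volume
    simp only [norm_neg, inner_neg_left, mul_neg, integral_neg] at h1
    linarith
  have hi3 : Integrable (fun w : EE n => u x * (a * (δ + ‖w‖ ^ 2) ^ (-a / 2 - 1) * inner ℝ w h)) := by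
    refine (hi.add hi2).congr (Eventually.of_forall fun w => ?_)
    simp only [Pi.add_apply, hv]; ring
  have hsplit : ∫ w, (u x - u (x - w)) * (a * (δ + ‖w‖ ^ 2) ^ (-a / 2 - 1) * inner ℝ w h) =
      (∫ w : EE n, u x * (a * (δ + ‖w‖ ^ 2) ^ (-a / 2 - 1) * inner ℝ w h)) -
      ∫ w, v w * (a * (δ + ‖w‖ ^ 2) ^ (-a / 2 - 1) * inner ℝ w h) := by
    rw [← integral_sub hi3 hi2]
    apply integral_congr_ae
    refine Eventually.of_forall fun w => ?_
    simp only [hv]; ring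
  rw [hsplit, hodd, zero_sub, hparts]
  simp [Neps]

/-- unnormalised Riesz gradient -/
def JJ (n : ℕ) (s : ℝ) (u : EE n → ℝ) (x : EE n) : EE n :=
  ∫ y, ((u x - u y) / ‖x - y‖ ^ ((n : ℝ) + s + 1)) • (x - y)

lemma JJ_eq (n : ℕ) (s : ℝ) (u : EE n → ℝ) (x : EE n) :
    JJ n s u x = ∫ w, ((u x - u (x - w)) / ‖w‖ ^ ((n : ℝ) + s + 1)) • w := by
  unfold JJ
  rw [← integral_sub_left_eq_self _ volume x]
  simp

lemma diff_bounds (n : ℕ) (u : EE n → ℝ)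
    (hu : ContDiff ℝ (⊤ : ℕ∞) u) (huc : HasCompactSupport u) (x : EE n) :
    ∃ A L : ℝ, (∀ w, |u x - u (x - w)| ≤ A) ∧ ∀ w, |u x - u (x - w)| ≤ L * ‖w‖ := by
  obtain ⟨B, hB⟩ := hu.continuous.bounded_above_of_compact_support huc
  obtain ⟨L, hL⟩ := hu.lipschitzWith_of_hasCompactSupport huc (by simp)
  refine ⟨B + B, L, fun w => ?_, fun w => ?_⟩
  · exact (abs_sub _ _).trans (add_le_add (hB _) (hB _))
  · have := hL.dist_le_mul x (x - w)
    rw [Real.dist_eq, dist_eq_norm] at this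
    simpa using this

lemma int_diff' (n : ℕ) (hn : 1 ≤ n) (s : ℝ) (hs0 : 0 < s) (hs1 : s < 1) (u : EE n → ℝ)
    (hu : ContDiff ℝ (⊤ : ℕ∞) u) (huc : HasCompactSupport u) (x : EE n) :
    Integrable (fun w => (u x - u (x - w)) * ‖w‖ ^ (-((n : ℝ) + s))) := by
  obtain ⟨A, L, hA, hL⟩ := diff_bounds n u hu huc x
  have := hu.continuous
  exact int_diff n hn s hs0 hs1 (fun w => u x - u (x - w)) (by fun_prop) A L hA hL

lemma norm_mul_rpow_aux {n : ℕ} (w : EE n) (b : ℝ) (hw : w ≠ 0) : ‖w‖ ^ (-(b + 1)) * ‖w‖ = ‖w‖ ^ (-b) := by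
  have h : 0 < ‖w‖ := norm_pos_iff.2 hw
  nth_rewrite 2 [← Real.rpow_one ‖w‖]
  rw [← Real.rpow_add h]; congr 1; ring

lemma JJ_inner (n : ℕ) (hn : 1 ≤ n) (s : ℝ) (hs0 : 0 < s) (hs1 : s < 1) (u : EE n → ℝ)
    (hu : ContDiff ℝ (⊤ : ℕ∞) u) (huc : HasCompactSupport u) (x h : EE n) :
    inner ℝ h (JJ n s u x) = ∫ w, (u x - u (x - w)) * (‖w‖ ^ (-((n : ℝ) + s + 1)) * inner ℝ w h) := by
  have hi : Integrable (fun w => ((u x - u (x - w)) / ‖w‖ ^ ((n : ℝ) + s + 1)) • w) := by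
    refine (int_diff' n hn s hs0 hs1 u hu huc x).mono ?_ ?_
    · apply Measurable.aestronglyMeasurable
      have := hu.continuous.measurable
      fun_prop
    · refine Eventually.of_forall fun w => ?_
      rw [norm_smul, norm_div, norm_mul]
      by_cases hw : w = 0
      · simp [hw]
      · rw [div_mul_eq_mul_div, mul_div_assoc]
        gcongr
        rw [Real.norm_of_nonneg (by positivity), Real.norm_of_nonneg (by positivity),
          ← norm_mul_rpow_aux w _ hw, Real.rpow_neg (norm_nonneg w), div_eq_inv_mul]
  rw [JJ_eq, ← integral_inner hi]
  apply integral_congr_ae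
  refine Eventually.of_forall fun w => ?_
  simp only [real_inner_smul_right]
  rw [Real.rpow_neg (norm_nonneg _), real_inner_comm]
  ring

lemma JJ_ibp (n : ℕ) (hn : 1 ≤ n) (s : ℝ) (hs0 : 0 < s) (hs1 : s < 1) (u : EE n → ℝ)
    (hu : ContDiff ℝ (⊤ : ℕ∞) u) (huc : HasCompactSupport u) (x h : EE n) :
    (n + s - 1) * inner ℝ h (JJ n s u x) =
      ∫ w, fderiv ℝ u (x - w) h * ‖w‖ ^ (-((n : ℝ) + s - 1)) := by
  have := EE_nontrivial n hn
  rw [JJ_inner n hn s hs0 hs1 u hu huc x h]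
  have hn1 : (1 : ℝ) ≤ n := by exact_mod_cast hn
  obtain ⟨a, ha⟩ : ∃ a : ℝ, a = (n : ℝ) + s - 1 := ⟨_, rfl⟩
  have ha0 : 0 < a := by linarith
  rw [← ha, show (n : ℝ) + s + 1 = a + 2 by linarith]
  have hd := int_diff' n hn s hs0 hs1 u hu huc x
  rw [show (n : ℝ) + s = a + 1 by linarith] at hd
  have hucont := hu.continuous
  have hfcont : Continuous (fun w => fderiv ℝ u (x - w) h) :=
    ((hu.continuous_fderiv (by simp)).comp (by fun_prop : Continuous (fun w : EE n => x - w))).clm_apply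
      continuous_const
  have hfcs : HasCompactSupport (fun w => fderiv ℝ u (x - w) h) :=
    (huc.fderiv_apply ℝ h).comp_homeomorph (Homeomorph.subLeft x)
  have hfi := int_cpt n hn a (by linarith) _ hfcont hfcs
  -- the sequence
  let δ : ℕ → ℝ := fun m => 1 / ((m : ℝ) + 1)
  have hδ : ∀ m, 0 < δ m := fun m => by positivity
  have hδt : Tendsto δ atTop (nhds 0) := tendsto_one_div_add_atTop_nhds_zero_nat
  have hne : ∀ᵐ w : EE n, w ≠ 0 := by
    rw [ae_iff]; simp
  have hsq : ∀ (w : EE n) (b : ℝ), (‖w‖ ^ 2) ^ (-b / 2) = ‖w‖ ^ (-b) := by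
    intro w b
    rw [← Real.rpow_natCast, ← Real.rpow_mul (norm_nonneg w)]
    congr 1; push_cast; ring
  have hmono : ∀ (m : ℕ) (w : EE n) (b : ℝ), 0 ≤ b → w ≠ 0 → (δ m + ‖w‖ ^ 2) ^ (-b / 2) ≤ ‖w‖ ^ (-b) := by
    intro m w b hb hw
    have h0 : 0 < ‖w‖ := norm_pos_iff.2 hw
    rw [← hsq]
    apply Real.rpow_le_rpow_of_nonpos (by positivity) _ (by linarith)
    linarith [hδ m]
  have hlim : ∀ (w : EE n) (b : ℝ), w ≠ 0 →
      Tendsto (fun m => (δ m + ‖w‖ ^ 2) ^ (-b / 2)) atTop (nhds (‖w‖ ^ (-b))) := by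
    intro w b hw
    have h0 : 0 < ‖w‖ := norm_pos_iff.2 hw
    rw [← hsq]
    apply Tendsto.rpow_const
    · simpa using hδt.add_const (‖w‖ ^ 2)
    · left; positivity
  have e2 : -a / 2 - 1 = -(a + 2) / 2 := by ring
  have hL : Tendsto (fun m => ∫ w, (u x - u (x - w)) * (a * (δ m + ‖w‖ ^ 2) ^ (-a / 2 - 1) * inner ℝ w h)) atTop
      (nhds (∫ w, (u x - u (x - w)) * (a * ‖w‖ ^ (-(a + 2)) * inner ℝ w h))) := by
    apply tendsto_integral_of_dominated_convergence
      (fun w => (a * ‖h‖) * ‖(u x - u (x - w)) * ‖w‖ ^ (-(a + 1))‖)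
    · intro m
      apply Measurable.aestronglyMeasurable
      have := hucont.measurable
      fun_prop
    · exact hd.norm.const_mul _
    · intro m
      filter_upwards [hne] with w hw
      rw [norm_mul, norm_mul, norm_mul, norm_mul, e2, Real.norm_of_nonneg ha0.le,
        Real.norm_of_nonneg (by positivity : 0 ≤ ‖w‖ ^ (-(a + 1))),
        Real.norm_of_nonneg (by have := hδ m; positivity : 0 ≤ (δ m + ‖w‖ ^ 2) ^ (-(a + 2) / 2))]
      calc _ ≤ ‖u x - u (x - w)‖ * (a * ‖w‖ ^ (-(a + 2)) * (‖w‖ * ‖h‖)) := by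
            gcongr
            · exact hmono m w _ (by linarith) hw
            · exact norm_inner_le_norm _ _
        _ = ‖u x - u (x - w)‖ * (a * (‖w‖ ^ (-(a + 1 + 1)) * ‖w‖) * ‖h‖) := by
            rw [show a + 2 = a + 1 + 1 by ring]; ring
        _ = _ := by rw [norm_mul_rpow_aux w _ hw]; ring
    · filter_upwards [hne] with w hw
      rw [e2]
      exact ((((hlim w (a + 2) hw).const_mul a).mul_const _).const_mul _)
  have hR : Tendsto (fun m => ∫ w, fderiv ℝ u (x - w) h * (δ m + ‖w‖ ^ 2) ^ (-a / 2)) atTop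
      (nhds (∫ w, fderiv ℝ u (x - w) h * ‖w‖ ^ (-a))) := by
    apply tendsto_integral_of_dominated_convergence
      (fun w => ‖fderiv ℝ u (x - w) h * ‖w‖ ^ (-a)‖)
    · intro m
      apply Measurable.aestronglyMeasurable
      have := hfcont.measurable
      fun_prop
    · exact hfi.norm
    · intro m
      filter_upwards [hne] with w hw
      rw [norm_mul, norm_mul, Real.norm_of_nonneg (by positivity : 0 ≤ ‖w‖ ^ (-a)),
        Real.norm_of_nonneg (by have := hδ m; positivity : 0 ≤ (δ m + ‖w‖ ^ 2) ^ (-a / 2))]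
      gcongr
      exact hmono m w _ ha0.le hw
    · filter_upwards [hne] with w hw
      exact (hlim w a hw).const_mul _
  have heq : ∀ m, ∫ w, (u x - u (x - w)) * (a * (δ m + ‖w‖ ^ 2) ^ (-a / 2 - 1) * inner ℝ w h) =
      ∫ w, fderiv ℝ u (x - w) h * (δ m + ‖w‖ ^ 2) ^ (-a / 2) := by
    intro m
    apply ibp_eps n a (δ m) (hδ m) u hu huc x h
    refine (hd.norm.const_mul (a * ‖h‖)).mono' ?_ ?_
    · apply Measurable.aestronglyMeasurable
      have := hucont.measurable
      fun_prop
    · filter_upwards [hne] with w hw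
      rw [norm_mul, norm_mul, norm_mul, norm_mul, e2, Real.norm_of_nonneg ha0.le,
        Real.norm_of_nonneg (by positivity : 0 ≤ ‖w‖ ^ (-(a + 1))),
        Real.norm_of_nonneg (by have := hδ m; positivity : 0 ≤ (δ m + ‖w‖ ^ 2) ^ (-(a + 2) / 2))]
      calc _ ≤ ‖u x - u (x - w)‖ * (a * ‖w‖ ^ (-(a + 2)) * (‖w‖ * ‖h‖)) := by
            gcongr
            · exact hmono m w _ (by linarith) hw
            · exact norm_inner_le_norm _ _
        _ = ‖u x - u (x - w)‖ * (a * (‖w‖ ^ (-(a + 1 + 1)) * ‖w‖) * ‖h‖) := by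
            rw [show a + 2 = a + 1 + 1 by ring]; ring
        _ = _ := by rw [norm_mul_rpow_aux w _ hw]; ring
  simp_rw [heq] at hL
  have hfin := tendsto_nhds_unique hL hR
  rw [← hfin, ← integral_const_mul]
  apply integral_congr_ae
  refine Eventually.of_forall fun w => ?_
  simp only
  ring

lemma JJ_meas (n : ℕ) (s : ℝ) (u : EE n → ℝ) (hu : Continuous u) : StronglyMeasurable (JJ n s u) := by
  unfold JJ
  apply StronglyMeasurable.integral_prod_right
  have := hu.measurable
  apply Measurable.stronglyMeasurable
  unfold Function.uncurry
  fun_prop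

/-- the (vector valued) truncated kernel -/
def KK (n : ℕ) (s R : ℝ) (z : EE n) : EE n :=
  ∫ y : EE n, (if ‖y‖ < R then ‖z - y‖ ^ (-((n : ℝ) + s - 1)) * ‖y‖ ^ (-((n : ℝ) + 1 - s)) else 0) • y

lemma KK_isom (n : ℕ) (s R : ℝ) (z : EE n) (T : EE n ≃ₗᵢ[ℝ] EE n) :
    KK n s R (T z) = T (KK n s R z) := by
  unfold KK
  have h1 := T.toContinuousLinearEquiv.integral_comp_comm (μ := volume)
    (fun y : EE n => (if ‖y‖ < R then ‖z - y‖ ^ (-((n : ℝ) + s - 1)) * ‖y‖ ^ (-((n : ℝ) + 1 - s)) else 0) • y)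
  have h2 : ∀ v, T.toContinuousLinearEquiv v = T v := fun v => rfl
  rw [h2] at h1
  rw [← h1, ← T.measurePreserving.integral_comp T.toHomeomorph.measurableEmbedding]
  apply integral_congr_ae
  refine Eventually.of_forall fun w => ?_
  simp only [h2, map_smul, LinearIsometryEquiv.norm_map]
  rw [← map_sub, LinearIsometryEquiv.norm_map]

lemma KK_scale (n : ℕ) (s R t : ℝ) (ht : 0 < t) (z : EE n) :
    KK n s (t * R) (t • z) = t ^ (1 - (n : ℝ)) • KK n s R z := by
  have h := Measure.integral_comp_smul volume (fun y : EE n =>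
    (if ‖y‖ < t * R then ‖t • z - y‖ ^ (-((n : ℝ) + s - 1)) * ‖y‖ ^ (-((n : ℝ) + 1 - s)) else 0) • y) t
  have h3 : ∀ y : EE n, (if ‖t • y‖ < t * R then ‖t • z - t • y‖ ^ (-((n : ℝ) + s - 1)) * ‖t • y‖ ^ (-((n : ℝ) + 1 - s)) else 0) • t • y
     = (t ^ (1 - 2 * (n:ℝ))) • ((if ‖y‖ < R then ‖z - y‖ ^ (-((n : ℝ) + s - 1)) * ‖y‖ ^ (-((n : ℝ) + 1 - s)) else 0) • y) := by
    intro y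
    rw [← smul_sub, norm_smul, norm_smul, Real.norm_of_nonneg ht.le, smul_smul, smul_smul]
    have : (t * ‖y‖ < t * R) = (‖y‖ < R) := by rw [mul_lt_mul_iff_right₀ ht]
    simp only [this]
    split_ifs
    · rw [Real.mul_rpow ht.le (norm_nonneg _), Real.mul_rpow ht.le (norm_nonneg _)]
      have : t ^ (1 - 2 * (n:ℝ)) = t ^ (-((n : ℝ) + s - 1)) * t ^ (-((n : ℝ) + 1 - s)) * t := by
        nth_rewrite 4 [← Real.rpow_one t]
        rw [← Real.rpow_add ht, ← Real.rpow_add ht]; congr 1; ring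
      rw [this]; congr 1; ring
    · simp
  simp only [h3] at h
  rw [integral_smul, finrank_euclideanSpace_fin] at h
  unfold KK
  rw [abs_of_nonneg (by positivity)] at h
  have h4 := congrArg (fun v => (t ^ n) • v) h
  simp only [smul_smul] at h4
  rw [mul_inv_cancel₀ (by positivity), one_smul] at h4
  rw [← h4, ← Real.rpow_natCast, ← Real.rpow_add ht]
  congr 2; ring

/-- scalar profile -/
def hh (n : ℕ) (s : ℝ) (e : EE n) (R : ℝ) : ℝ := inner ℝ e (KK n s R e)

lemma KK_e (n : ℕ) (s R : ℝ) (e : EE n) (he : ‖e‖ = 1) : KK n s R e = hh n s e R • e := by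
  have h1 := KK_isom n s R e (Submodule.span ℝ {e}).reflection
  rw [Submodule.reflection_mem_subspace_eq_self (Submodule.mem_span_singleton_self e)] at h1
  have h2 := (Submodule.reflection_eq_self_iff _).1 h1.symm
  obtain ⟨c, hc⟩ := Submodule.mem_span_singleton.1 h2
  unfold hh
  rw [← hc, real_inner_smul_right, real_inner_self_eq_norm_sq, he]
  simp

lemma KK_formula (n : ℕ) (s R : ℝ) (e : EE n) (he : ‖e‖ = 1) (z : EE n) (hz : z ≠ 0) :
    KK n s R z = (hh n s e (R / ‖z‖) * ‖z‖ ^ (-(n : ℝ))) • z := by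
  have ht : 0 < ‖z‖ := norm_pos_iff.2 hz
  set θ : EE n := ‖z‖⁻¹ • z with hθ
  have hθ1 : ‖e‖ = ‖θ‖ := by rw [he, hθ, norm_smul, norm_inv, norm_norm, inv_mul_cancel₀ ht.ne']
  have h1 : z = ‖z‖ • θ := by rw [hθ, smul_smul, mul_inv_cancel₀ ht.ne', one_smul]
  have h2 : KK n s R z = ‖z‖ ^ (1 - (n : ℝ)) • KK n s (R / ‖z‖) θ := by
    rw [← KK_scale n s _ _ ht, ← h1, mul_div_cancel₀ _ ht.ne']
  have h3 := KK_isom n s (R / ‖z‖) e (Submodule.span ℝ {e - θ})ᗮ.reflection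
  rw [Submodule.reflection_sub hθ1, KK_e n s _ e he, map_smul, Submodule.reflection_sub hθ1] at h3
  rw [h2, h3, hθ, smul_smul, smul_smul]
  congr 1
  have : ‖z‖ ^ (1 - (n : ℝ)) = ‖z‖ ^ (-(n : ℝ)) * ‖z‖ := by
    nth_rewrite 3 [← Real.rpow_one ‖z‖]
    rw [← Real.rpow_add ht]; congr 1; ring
  rw [this]; field_simp

lemma int_kernel_prod (n : ℕ) (hn : 1 ≤ n) (s : ℝ) (hs0 : 0 < s) (hs1 : s < 1) (e : EE n)
    (he : ‖e‖ = 1) (R : ℝ) :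
    IntegrableOn (fun y : EE n => ‖e - y‖ ^ (-((n : ℝ) + s - 1)) * ‖y‖ ^ (-((n : ℝ) - s)))
      (Metric.ball 0 R) := by
  have hn1 : (1:ℝ) ≤ n := by exact_mod_cast hn
  set a : ℝ := (n : ℝ) + s - 1 with ha
  have ha0 : 0 < a := by rw [ha]; linarith
  have h1 : IntegrableOn (fun y : EE n => (1/2 : ℝ) ^ (-a) * ‖y‖ ^ (-((n : ℝ) - s))) (Metric.ball 0 R) :=
    (int_ball n hn _ R (by linarith)).const_mul _
  have h2 : IntegrableOn (fun y : EE n => (1/2 : ℝ) ^ (-((n : ℝ) - s)) * ‖e - y‖ ^ (-a)) (Metric.ball 0 R) := by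
    apply Integrable.const_mul
    have h3 := (integrable_indicator_iff measurableSet_ball).2 (int_ball n hn a (R + 1) (by rw [ha]; linarith))
    have h4 := (h3.comp_sub_left e).integrableOn (s := Metric.ball 0 R)
    refine h4.congr_fun ?_ measurableSet_ball
    intro y hy
    have : e - y ∈ Metric.ball (0 : EE n) (R + 1) := by
      rw [mem_ball_zero_iff] at hy ⊢
      have := norm_sub_le e y
      linarith
    simp [Set.indicator_of_mem this]
  refine (h1.add h2).mono' ?_ ?_
  · apply Measurable.aestronglyMeasurable; fun_prop
  · refine Eventually.of_forall fun y => ?_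
    rw [Real.norm_of_nonneg (by positivity)]
    simp only [Pi.add_apply]
    rcases le_total ‖y‖ (1/2) with h | h
    · have : 1 / 2 ≤ ‖e - y‖ := by
        have := norm_sub_norm_le e y
        linarith
      have h5 : ‖e - y‖ ^ (-a) ≤ (1/2 : ℝ) ^ (-a) :=
        Real.rpow_le_rpow_of_nonpos (by norm_num) this (by linarith)
      have h6 : 0 ≤ (1/2 : ℝ) ^ (-((n : ℝ) - s)) * ‖e - y‖ ^ (-a) := by positivity
      have h7 := mul_le_mul_of_nonneg_right h5 (by positivity : 0 ≤ ‖y‖ ^ (-((n : ℝ) - s)))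
      linarith
    · have h5 : ‖y‖ ^ (-((n : ℝ) - s)) ≤ (1/2 : ℝ) ^ (-((n : ℝ) - s)) :=
        Real.rpow_le_rpow_of_nonpos (by norm_num) h (by linarith)
      have h6 : 0 ≤ (1/2 : ℝ) ^ (-a) * ‖y‖ ^ (-((n : ℝ) - s)) := by positivity
      have h7 := mul_le_mul_of_nonneg_left h5 (by positivity : 0 ≤ ‖e - y‖ ^ (-a))
      linarith

def Phi (n : ℕ) (s : ℝ) (e y : EE n) : ℝ :=
  1 / 2 * (inner ℝ e y * ‖y‖ ^ (-((n : ℝ) + 1 - s)) *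
    (‖e - y‖ ^ (-((n : ℝ) + s - 1)) - ‖e + y‖ ^ (-((n : ℝ) + s - 1))))

lemma Phi0_int (n : ℕ) (hn : 1 ≤ n) (s : ℝ) (hs0 : 0 < s) (hs1 : s < 1) (e : EE n)
    (he : ‖e‖ = 1) (R : ℝ) :
    IntegrableOn (fun y : EE n => inner ℝ e y * ‖y‖ ^ (-((n : ℝ) + 1 - s)) *
      ‖e - y‖ ^ (-((n : ℝ) + s - 1))) (Metric.ball 0 R) := by
  refine (int_kernel_prod n hn s hs0 hs1 e he R).mono' ?_ ?_
  · apply Measurable.aestronglyMeasurable; fun_prop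
  · refine Eventually.of_forall fun y => ?_
    rw [norm_mul, norm_mul, Real.norm_of_nonneg (by positivity : 0 ≤ ‖y‖ ^ (-((n : ℝ) + 1 - s))),
      Real.norm_of_nonneg (by positivity : 0 ≤ ‖e - y‖ ^ (-((n : ℝ) + s - 1)))]
    by_cases hy : y = 0
    · subst hy; simp; positivity
    · have h1 : ‖inner ℝ e y‖ ≤ ‖y‖ := by
        have := norm_inner_le_norm (𝕜 := ℝ) e y
        rwa [he, one_mul] at this
      rw [← norm_mul_rpow_aux y ((n : ℝ) - s) hy, show (n : ℝ) - s + 1 = n + 1 - s by ring,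
        mul_comm (‖e - y‖ ^ _), mul_comm (‖y‖ ^ _) ‖y‖]
      gcongr

lemma Phi0_neg_int (n : ℕ) (hn : 1 ≤ n) (s : ℝ) (hs0 : 0 < s) (hs1 : s < 1) (e : EE n)
    (he : ‖e‖ = 1) (R : ℝ) :
    IntegrableOn (fun y : EE n => inner ℝ e y * ‖y‖ ^ (-((n : ℝ) + 1 - s)) *
      ‖e + y‖ ^ (-((n : ℝ) + s - 1))) (Metric.ball 0 R) ∧
    ∫ y in Metric.ball 0 R, inner ℝ e y * ‖y‖ ^ (-((n : ℝ) + 1 - s)) * ‖e + y‖ ^ (-((n : ℝ) + s - 1))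
    = - ∫ y in Metric.ball 0 R, inner ℝ e y * ‖y‖ ^ (-((n : ℝ) + 1 - s)) * ‖e - y‖ ^ (-((n : ℝ) + s - 1)) := by
  have h := (integrable_indicator_iff measurableSet_ball).2 (Phi0_int n hn s hs0 hs1 e he R)
  have key : (Metric.ball (0 : EE n) R).indicator (fun y : EE n => inner ℝ e y * ‖y‖ ^ (-((n : ℝ) + 1 - s)) *
      ‖e + y‖ ^ (-((n : ℝ) + s - 1))) = fun y => - (Metric.ball (0 : EE n) R).indicator (fun y : EE n => inner ℝ e y * ‖y‖ ^ (-((n : ℝ) + 1 - s)) *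
      ‖e - y‖ ^ (-((n : ℝ) + s - 1))) (-y) := by
    ext y
    by_cases hy : y ∈ Metric.ball (0 : EE n) R
    · have : -y ∈ Metric.ball (0 : EE n) R := by simpa using hy
      simp [Set.indicator_of_mem hy, Set.indicator_of_mem this]
    · have : -y ∉ Metric.ball (0 : EE n) R := by simpa using hy
      simp [Set.indicator_of_notMem hy, Set.indicator_of_notMem this]
  constructor
  · rw [← integrable_indicator_iff measurableSet_ball, key]
    exact h.comp_neg.neg
  · rw [← integral_indicator measurableSet_ball, ← integral_indicator measurableSet_ball, key,
      integral_neg, integral_neg_eq_self]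

lemma hh_eq (n : ℕ) (hn : 1 ≤ n) (s : ℝ) (hs0 : 0 < s) (hs1 : s < 1) (e : EE n)
    (he : ‖e‖ = 1) (R : ℝ) :
    hh n s e R = ∫ y in Metric.ball 0 R, Phi n s e y := by
  have h1 : hh n s e R = ∫ y in Metric.ball 0 R, inner ℝ e y * ‖y‖ ^ (-((n : ℝ) + 1 - s)) * ‖e - y‖ ^ (-((n : ℝ) + s - 1)) := by
    unfold hh KK
    rw [← integral_inner, ← integral_indicator measurableSet_ball]
    · apply integral_congr_ae
      refine Eventually.of_forall fun y => ?_
      simp only [Set.indicator, mem_ball_zero_iff, real_inner_smul_right]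
      split_ifs <;> ring
    · have := (integrable_indicator_iff measurableSet_ball).2 (int_kernel_prod n hn s hs0 hs1 e he R)
      refine this.mono ?_ ?_
      · apply Measurable.aestronglyMeasurable
        have hm : Measurable (fun y : EE n => if ‖y‖ < R then ‖e - y‖ ^ (-((n : ℝ) + s - 1)) * ‖y‖ ^ (-((n : ℝ) + 1 - s)) else 0) := by
          refine Measurable.ite ?_ (by fun_prop) (by fun_prop)
          exact measurableSet_lt measurable_norm measurable_const
        exact hm.smul measurable_id
      · refine Eventually.of_forall fun y => ?_
        simp only [Set.indicator, mem_ball_zero_iff]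
        split_ifs
        · by_cases hy : y = 0
          · subst hy; simp; positivity
          · rw [norm_smul, Real.norm_of_nonneg (by positivity), Real.norm_of_nonneg (by positivity),
              ← norm_mul_rpow_aux y ((n : ℝ) - s) hy, show (n : ℝ) - s + 1 = n + 1 - s by ring, mul_assoc]
        · simp
  obtain ⟨h2, h3⟩ := Phi0_neg_int n hn s hs0 hs1 e he R
  unfold Phi
  rw [integral_const_mul]
  simp only [mul_sub]
  rw [integral_sub (Phi0_int n hn s hs0 hs1 e he R) h2, h3, h1]
  ring

lemma Phi_int (n : ℕ) (hn : 1 ≤ n) (s : ℝ) (hs0 : 0 < s) (hs1 : s < 1) (e : EE n)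
    (he : ‖e‖ = 1) : Integrable (Phi n s e) := by
  have hn1 : (1:ℝ) ≤ n := by exact_mod_cast hn
  rw [← integrableOn_univ, ← Set.union_compl_self (Metric.ball (0 : EE n) 2)]
  refine IntegrableOn.union ?_ ?_
  · have := ((Phi0_int n hn s hs0 hs1 e he 2).sub (Phi0_neg_int n hn s hs0 hs1 e he 2).1).const_mul (1/2)
    refine this.congr (Eventually.of_forall fun y => ?_)
    simp only [Phi, Pi.sub_apply]; ring
  · set a : ℝ := (n : ℝ) + s - 1 with ha
    have ha0 : 0 < a := by rw [ha]; linarith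
    refine ((int_compl n hn (2 * n) 2 (by norm_num) (by linarith)).const_mul
      (a * (1/2) ^ (-a-1))).mono' ?_ ?_
    · apply Measurable.aestronglyMeasurable; unfold Phi; fun_prop
    · refine (ae_restrict_iff' measurableSet_ball.compl).2 (Eventually.of_forall fun y hy => ?_)
      have hy2 : 2 ≤ ‖y‖ := by simpa using hy
      have hy0 : 0 < ‖y‖ := by linarith
      have hb : ‖‖e - y‖ ^ (-a) - ‖e + y‖ ^ (-a)‖ ≤ (a * (1/2 * ‖y‖) ^ (-a-1)) * 2 := by
        have hm1 : 1/2 * ‖y‖ ≤ ‖e - y‖ := by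
          have := norm_sub_norm_le y e
          rw [norm_sub_rev] at this; linarith
        have hm2 : 1/2 * ‖y‖ ≤ ‖e + y‖ := by
          have := norm_sub_norm_le y (-e)
          rw [sub_neg_eq_add, norm_neg, add_comm y] at this; linarith
        have hd : ‖‖e - y‖ - ‖e + y‖‖ ≤ 2 := by
          rw [Real.norm_eq_abs, abs_sub_comm]
          have := abs_norm_sub_norm_le (e + y) (y - e)
          rw [show e + y - (y - e) = (2 : ℝ) • e by rw [two_smul]; abel, norm_smul, he, norm_sub_rev y e] at this
          simpa using this
        have := Convex.norm_image_sub_le_of_norm_hasDerivWithin_le (𝕜 := ℝ) (f := fun r : ℝ => r ^ (-a))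
          (f' := fun r => (-a) * r ^ (-a-1)) (s := Set.Ici (1/2 * ‖y‖)) (C := a * (1/2 * ‖y‖) ^ (-a-1))
          (x := ‖e + y‖) (y := ‖e - y‖) ?_ ?_ (convex_Ici _) hm2 hm1
        · refine this.trans ?_
          gcongr
        · intro r hr
          have hr0 : 0 < r := lt_of_lt_of_le (by positivity) hr
          exact (Real.hasDerivAt_rpow_const (Or.inl hr0.ne')).hasDerivWithinAt
        · intro r hr
          have hr0 : 0 < r := lt_of_lt_of_le (by positivity) hr
          rw [norm_mul, norm_neg, Real.norm_of_nonneg ha0.le, Real.norm_of_nonneg (by positivity)]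
          refine mul_le_mul_of_nonneg_left ?_ ha0.le
          exact Real.rpow_le_rpow_of_nonpos (by positivity) (Set.mem_Ici.1 hr) (by linarith)
      have h1 : ‖inner ℝ e y‖ ≤ ‖y‖ := by
        have := norm_inner_le_norm (𝕜 := ℝ) e y
        rwa [he, one_mul] at this
      unfold Phi
      rw [norm_mul, norm_mul, norm_mul, Real.norm_of_nonneg (by positivity : 0 ≤ ‖y‖ ^ (-((n : ℝ) + 1 - s)))]
      rw [Real.norm_of_nonneg (by norm_num : (0:ℝ) ≤ 1/2), ← ha]
      calc _ ≤ 1 / 2 * (‖y‖ * ‖y‖ ^ (-((n : ℝ) + 1 - s)) * ((a * (1/2 * ‖y‖) ^ (-a-1)) * 2)) := by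
            gcongr
        _ = _ := by
            rw [Real.mul_rpow (by norm_num) hy0.le]
            have : ‖y‖ ^ (-(2 * (n:ℝ))) = ‖y‖ * ‖y‖ ^ (-((n : ℝ) + 1 - s)) * ‖y‖ ^ (-a-1) := by
              nth_rewrite 2 [← Real.rpow_one ‖y‖]
              rw [← Real.rpow_add hy0, ← Real.rpow_add hy0]; congr 1; rw [ha]; ring
            rw [this]; ring

lemma Phi_sign (n : ℕ) (hn : 1 ≤ n) (s : ℝ) (hs0 : 0 < s) (hs1 : s < 1) (e : EE n)
    (he : ‖e‖ = 1) (y : EE n) (h1 : y ≠ e) (h2 : y ≠ -e) :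
    0 ≤ Phi n s e y ∧ (inner ℝ e y ≠ 0 → 0 < Phi n s e y) := by
  have hn1 : (1:ℝ) ≤ n := by exact_mod_cast hn
  have p1 : 0 < ‖e - y‖ := norm_pos_iff.2 (sub_ne_zero.2 h1.symm)
  have p2 : 0 < ‖e + y‖ := norm_pos_iff.2 (fun h => h2 (by rw [eq_neg_iff_add_eq_zero, add_comm]; exact h))
  have q1 := norm_add_sq_real e y
  have q2 := norm_sub_sq_real e y
  have key : inner ℝ e y ≠ 0 → 0 < Phi n s e y := by
    intro hne
    have hy : y ≠ 0 := by rintro rfl; simp at hne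
    have hy0 : 0 < ‖y‖ := norm_pos_iff.2 hy
    have hyp : 0 < ‖y‖ ^ (-((n : ℝ) + 1 - s)) := by positivity
    unfold Phi
    have ha : -((n : ℝ) + s - 1) < 0 := by linarith
    rcases lt_or_gt_of_ne hne with h | h
    · have hlt : ‖e + y‖ < ‖e - y‖ := by
        apply lt_of_pow_lt_pow_left₀ 2 (norm_nonneg _); linarith
      have := Real.rpow_lt_rpow_of_neg p2 hlt ha
      have := mul_pos_of_neg_of_neg (mul_neg_of_neg_of_pos h hyp) (sub_neg.2 this)
      linarith
    · have hlt : ‖e - y‖ < ‖e + y‖ := by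
        apply lt_of_pow_lt_pow_left₀ 2 (norm_nonneg _); linarith
      have := Real.rpow_lt_rpow_of_neg p1 hlt ha
      have := mul_pos (mul_pos h hyp) (sub_pos.2 this)
      linarith
  refine ⟨?_, key⟩
  by_cases h : inner ℝ e y = 0
  · unfold Phi; rw [h]; simp
  · exact (key h).le

lemma Phi_nonneg (n : ℕ) (hn : 1 ≤ n) (s : ℝ) (hs0 : 0 < s) (hs1 : s < 1) (e : EE n)
    (he : ‖e‖ = 1) : 0 ≤ᵐ[volume] Phi n s e := by
  have := EE_nontrivial n hn
  filter_upwards [Measure.ae_ne volume e, Measure.ae_ne volume (-e)] with y h1 h2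
  exact (Phi_sign n hn s hs0 hs1 e he y h1 h2).1

lemma Phi_pos (n : ℕ) (hn : 1 ≤ n) (s : ℝ) (hs0 : 0 < s) (hs1 : s < 1) (e : EE n)
    (he : ‖e‖ = 1) : 0 < ∫ y, Phi n s e y := by
  rw [integral_pos_iff_support_of_nonneg_ae (Phi_nonneg n hn s hs0 hs1 e he) (Phi_int n hn s hs0 hs1 e he)]
  refine lt_of_lt_of_le (Metric.measure_ball_pos volume ((1/2 : ℝ) • e) (by norm_num : (0:ℝ) < 1/4)) (measure_mono ?_)
  intro y hy
  rw [mem_ball_iff_norm] at hy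
  have hin : 0 < inner ℝ e y := by
    have h1 : inner ℝ e y = inner ℝ e (y - (1/2 : ℝ) • e) + 1/2 := by
      rw [inner_sub_right, real_inner_smul_right, real_inner_self_eq_norm_sq, he]; ring
    have h2 := abs_real_inner_le_norm e (y - (1/2 : ℝ) • e)
    rw [he, one_mul] at h2
    have := neg_abs_le (inner ℝ e (y - (1/2 : ℝ) • e))
    linarith
  refine ((Phi_sign n hn s hs0 hs1 e he y ?_ ?_).2 hin.ne').ne'
  · rintro rfl
    have : y - (1/2 : ℝ) • y = (1/2 : ℝ) • y := by
      nth_rewrite 1 [← one_smul ℝ y]; rw [← sub_smul]; norm_num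
    rw [this, norm_smul, he] at hy
    norm_num at hy
  · rintro rfl
    rw [inner_neg_right, real_inner_self_eq_norm_sq, he] at hin
    norm_num at hin

lemma hh_bounds (n : ℕ) (hn : 1 ≤ n) (s : ℝ) (hs0 : 0 < s) (hs1 : s < 1) (e : EE n)
    (he : ‖e‖ = 1) (R : ℝ) : |hh n s e R| ≤ ∫ y, Phi n s e y := by
  rw [hh_eq n hn s hs0 hs1 e he, abs_of_nonneg]
  · exact setIntegral_le_integral (Phi_int n hn s hs0 hs1 e he) (Phi_nonneg n hn s hs0 hs1 e he)
  · exact setIntegral_nonneg_of_ae (Phi_nonneg n hn s hs0 hs1 e he)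

lemma hh_tendsto (n : ℕ) (hn : 1 ≤ n) (s : ℝ) (hs0 : 0 < s) (hs1 : s < 1) (e : EE n)
    (he : ‖e‖ = 1) : Tendsto (hh n s e) atTop (nhds (∫ y, Phi n s e y)) := by
  have h : AECover volume atTop (fun R : ℝ => Metric.ball (0 : EE n) R) := aecover_ball tendsto_id
  have := h.integral_tendsto_of_countably_generated (Phi_int n hn s hs0 hs1 e he)
  refine this.congr fun R => ?_
  rw [hh_eq n hn s hs0 hs1 e he]

lemma polar_int (n : ℕ) (hn : 1 ≤ n) (F : EE n → ℝ) (hF : Integrable F) :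
    ∫ z, F z = ∫ θ : Metric.sphere (0 : EE n) 1, (∫ r in Set.Ioi (0:ℝ), r ^ (n - 1) * F (r • (θ : EE n)))
      ∂(volume : Measure (EE n)).toSphere := by
  have := EE_nontrivial n hn
  have h1 : ∫ z, F z = ∫ x : ({(0)}ᶜ : Set (EE n)), F x.1 ∂((volume : Measure (EE n)).comap (↑)) := by
    rw [integral_subtype_comap (measurableSet_singleton _).compl F, restrict_compl_singleton]
  have mp := (volume : Measure (EE n)).measurePreserving_homeomorphUnitSphereProd
  have h2 : ∫ x : ({(0)}ᶜ : Set (EE n)), F x.1 ∂((volume : Measure (EE n)).comap (↑))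
      = ∫ q : Metric.sphere (0 : EE n) 1 × Set.Ioi (0:ℝ), F (q.2.1 • q.1.1)
        ∂(volume : Measure (EE n)).toSphere.prod (.volumeIoiPow (Module.finrank ℝ (EE n) - 1)) := by
    rw [← mp.integral_comp (Homeomorph.measurableEmbedding _)]
    apply integral_congr_ae
    refine Eventually.of_forall fun z => ?_
    simp only
    rw [← homeomorphUnitSphereProd_symm_apply_coe, Homeomorph.symm_apply_apply]
  have hi : Integrable (fun q : Metric.sphere (0 : EE n) 1 × Set.Ioi (0:ℝ) => F (q.2.1 • q.1.1))
      ((volume : Measure (EE n)).toSphere.prod (.volumeIoiPow (Module.finrank ℝ (EE n) - 1))) := by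
    rw [← mp.integrable_comp_emb (Homeomorph.measurableEmbedding _)]
    have : Integrable (fun x : ({(0)}ᶜ : Set (EE n)) => F x.1) ((volume : Measure (EE n)).comap (↑)) := by
      have h := hF.integrableOn (s := ({0}ᶜ : Set (EE n)))
      rwa [IntegrableOn, ← map_comap_subtype_coe (measurableSet_singleton _).compl,
        (MeasurableEmbedding.subtype_coe (measurableSet_singleton _).compl).integrable_map_iff] at h
    refine this.congr (Eventually.of_forall fun z => ?_)
    simp only [Function.comp]
    rw [← homeomorphUnitSphereProd_symm_apply_coe, Homeomorph.symm_apply_apply]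
  rw [h1, h2, integral_prod _ hi]
  apply integral_congr_ae
  refine Eventually.of_forall fun θ => ?_
  simp only [Measure.volumeIoiPow, ENNReal.ofReal]
  rw [integral_withDensity_eq_integral_smul, finrank_euclideanSpace_fin,
        integral_subtype_comap measurableSet_Ioi fun a ↦ Real.toNNReal (a ^ (n - 1)) • F (a • θ.1),
        setIntegral_congr_fun measurableSet_Ioi fun x hx ↦ ?_]
  · rw [NNReal.smul_def, Real.coe_toNNReal _ (pow_nonneg hx.out.le _)]; rfl
  · exact (measurable_subtype_coe.pow_const _).real_toNNReal

lemma radial_int (n : ℕ) (u : EE n → ℝ)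
    (hu : ContDiff ℝ (⊤ : ℕ∞) u) (huc : HasCompactSupport u) (x θ : EE n) (hθ : ‖θ‖ = 1) :
    ∫ r in Set.Ioi (0:ℝ), fderiv ℝ u (x - r • θ) θ = u x := by
  set g : ℝ → ℝ := fun r => u (x - r • θ) with hg
  have hgc : ContDiff ℝ 1 g := (hu.of_le (by simp)).comp (by fun_prop)
  have hgs : HasCompactSupport g := by
    have hcl : Topology.IsClosedEmbedding (fun r : ℝ => x - r • θ) := by
      apply AntilipschitzWith.isClosedEmbedding (K := 1)
      · apply AntilipschitzWith.of_le_mul_dist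
        intro r t
        rw [dist_eq_norm, dist_eq_norm, _root_.sub_sub_sub_cancel_left, ← sub_smul, norm_smul, hθ, norm_sub_rev]
        simp
      · apply LipschitzWith.uniformContinuous (K := 1)
        apply LipschitzWith.of_dist_le_mul
        intro r t
        rw [dist_eq_norm, dist_eq_norm, _root_.sub_sub_sub_cancel_left, ← sub_smul, norm_smul, hθ, norm_sub_rev]
        simp
    exact huc.comp_isClosedEmbedding hcl
  have h := HasCompactSupport.integral_Ioi_deriv_eq hgc hgs 0
  have hd : ∀ r, deriv g r = - fderiv ℝ u (x - r • θ) θ := by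
    intro r
    have h1 : HasDerivAt (fun r : ℝ => x - r • θ) (-θ) r := by
      have := ((hasDerivAt_id r).smul_const θ).const_sub x
      simpa using this
    have h2 := ((hu.differentiable (by simp)) (x - r • θ)).hasFDerivAt.comp_hasDerivAt r h1
    rw [map_neg] at h2
    exact h2.deriv
  simp only [hd] at h
  rw [integral_neg] at h
  simp only [hg, zero_smul, sub_zero] at h
  linarith

lemma fderiv_int (n : ℕ) (hn : 1 ≤ n) (u : EE n → ℝ)
    (hu : ContDiff ℝ (⊤ : ℕ∞) u) (huc : HasCompactSupport u) (x : EE n) :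
    Integrable (fun z => ‖fderiv ℝ u (x - z)‖ * ‖z‖ ^ (-((n : ℝ) - 1))) := by
  have h1 : Continuous (fderiv ℝ u) := hu.continuous_fderiv (by simp)
  apply int_cpt n hn _ (by linarith)
  · fun_prop
  · have : HasCompactSupport (fun z => fderiv ℝ u (x - z)) := by
      have := (huc.fderiv ℝ).comp_homeomorph (Homeomorph.subLeft x)
      exact this
    exact this.norm

lemma newton (n : ℕ) (hn : 1 ≤ n) (u : EE n → ℝ)
    (hu : ContDiff ℝ (⊤ : ℕ∞) u) (huc : HasCompactSupport u) (x : EE n) :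
    ∫ z, ‖z‖ ^ (-(n : ℝ)) * fderiv ℝ u (x - z) z
      = (volume : Measure (EE n)).toSphere.real Set.univ * u x := by
  have h1 : Continuous (fderiv ℝ u) := hu.continuous_fderiv (by simp)
  have hi : Integrable (fun z : EE n => ‖z‖ ^ (-(n : ℝ)) * fderiv ℝ u (x - z) z) := by
    refine (fderiv_int n hn u hu huc x).mono' ?_ ?_
    · apply Measurable.aestronglyMeasurable
      have : Measurable (fun z => fderiv ℝ u (x - z) z) := by
        have : Continuous (fun z => fderiv ℝ u (x - z) z) := by fun_prop
        exact this.measurable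
      fun_prop
    · refine Eventually.of_forall fun z => ?_
      by_cases hz : z = 0
      · subst hz; simp; positivity
      rw [norm_mul, Real.norm_of_nonneg (by positivity), ← norm_mul_rpow_aux z ((n : ℝ) - 1) hz, sub_add_cancel]
      have := (fderiv ℝ u (x - z)).le_opNorm z
      calc _ ≤ ‖z‖ ^ (-(n : ℝ)) * (‖fderiv ℝ u (x - z)‖ * ‖z‖) := by gcongr
        _ = _ := by ring
  rw [polar_int n hn _ hi]
  have : ∀ θ : Metric.sphere (0 : EE n) 1, (∫ r in Set.Ioi (0:ℝ), r ^ (n - 1) * (‖r • (θ : EE n)‖ ^ (-(n : ℝ)) * fderiv ℝ u (x - r • θ.1) (r • θ.1))) = u x := by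
    intro θ
    have hθ : ‖θ.1‖ = 1 := by simp
    rw [← radial_int n u hu huc x θ.1 hθ]
    apply setIntegral_congr_fun measurableSet_Ioi
    intro r hr
    have hr0 : 0 < r := hr
    simp only [map_smul, smul_eq_mul]
    rw [norm_smul, hθ, mul_one, Real.norm_of_nonneg hr0.le, Real.rpow_neg hr0.le, Real.rpow_natCast]
    have : r ^ n = r ^ (n-1) * r := by rw [← pow_succ, Nat.sub_add_cancel hn]
    rw [this]
    field_simp
  simp only [this]
  simp

lemma int_kernel_prod' (n : ℕ) (hn : 1 ≤ n) (s : ℝ) (hs0 : 0 < s) (hs1 : s < 1) (e : EE n)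
    (he : e ≠ 0) (R : ℝ) :
    IntegrableOn (fun y : EE n => ‖e - y‖ ^ (-((n : ℝ) + s - 1)) * ‖y‖ ^ (-((n : ℝ) - s)))
      (Metric.ball 0 R) := by
  have hn1 : (1:ℝ) ≤ n := by exact_mod_cast hn
  have ht : 0 < ‖e‖ := norm_pos_iff.2 he
  set t := 1/2 * ‖e‖ with htd
  have ht0 : 0 < t := by positivity
  set a : ℝ := (n : ℝ) + s - 1 with ha
  have ha0 : 0 < a := by rw [ha]; linarith
  have h1 : IntegrableOn (fun y : EE n => t ^ (-a) * ‖y‖ ^ (-((n : ℝ) - s))) (Metric.ball 0 R) :=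
    (int_ball n hn _ R (by linarith)).const_mul _
  have h2 : IntegrableOn (fun y : EE n => t ^ (-((n : ℝ) - s)) * ‖e - y‖ ^ (-a)) (Metric.ball 0 R) := by
    apply Integrable.const_mul
    have h3 := (integrable_indicator_iff measurableSet_ball).2 (int_ball n hn a (R + ‖e‖) (by rw [ha]; linarith))
    have h4 := (h3.comp_sub_left e).integrableOn (s := Metric.ball 0 R)
    refine h4.congr_fun ?_ measurableSet_ball
    intro y hy
    have : e - y ∈ Metric.ball (0 : EE n) (R + ‖e‖) := by
      rw [mem_ball_zero_iff] at hy ⊢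
      have := norm_sub_le e y
      linarith
    simp [Set.indicator_of_mem this]
  refine (h1.add h2).mono' ?_ ?_
  · apply Measurable.aestronglyMeasurable; fun_prop
  · refine Eventually.of_forall fun y => ?_
    rw [Real.norm_of_nonneg (by positivity)]
    simp only [Pi.add_apply]
    rcases le_total ‖y‖ t with h | h
    · have : t ≤ ‖e - y‖ := by
        have := norm_sub_norm_le e y
        linarith
      have h5 : ‖e - y‖ ^ (-a) ≤ t ^ (-a) :=
        Real.rpow_le_rpow_of_nonpos ht0 this (by linarith)
      have h6 : 0 ≤ t ^ (-((n : ℝ) - s)) * ‖e - y‖ ^ (-a) := by positivity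
      have h7 := mul_le_mul_of_nonneg_right h5 (by positivity : 0 ≤ ‖y‖ ^ (-((n : ℝ) - s)))
      linarith
    · have h5 : ‖y‖ ^ (-((n : ℝ) - s)) ≤ t ^ (-((n : ℝ) - s)) :=
        Real.rpow_le_rpow_of_nonpos ht0 h (by linarith)
      have h6 : 0 ≤ t ^ (-a) * ‖y‖ ^ (-((n : ℝ) - s)) := by positivity
      have h7 := mul_le_mul_of_nonneg_left h5 (by positivity : 0 ≤ ‖e - y‖ ^ (-a))
      linarith

lemma KKint_meas (n : ℕ) (s R : ℝ) : Measurable (fun q : EE n × EE n =>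
    (if ‖q.2‖ < R then ‖q.1 - q.2‖ ^ (-((n : ℝ) + s - 1)) * ‖q.2‖ ^ (-((n : ℝ) + 1 - s)) else 0)) := by
  refine Measurable.ite ?_ (by fun_prop) (by fun_prop)
  exact measurableSet_lt (by fun_prop) measurable_const

lemma KK_integrand (n : ℕ) (hn : 1 ≤ n) (s : ℝ) (hs0 : 0 < s) (hs1 : s < 1) (z : EE n)
    (hz : z ≠ 0) (R : ℝ) :
    Integrable (fun y : EE n => (if ‖y‖ < R then ‖z - y‖ ^ (-((n : ℝ) + s - 1)) * ‖y‖ ^ (-((n : ℝ) + 1 - s)) else 0) • y) := by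
  have := (integrable_indicator_iff measurableSet_ball).2 (int_kernel_prod' n hn s hs0 hs1 z hz R)
  refine this.mono ?_ ?_
  · apply Measurable.aestronglyMeasurable
    have hm := (KKint_meas n s R).comp (measurable_prodMk_left (x := z))
    exact hm.smul measurable_id
  · refine Eventually.of_forall fun y => ?_
    simp only [Set.indicator, mem_ball_zero_iff]
    split_ifs
    · by_cases hy : y = 0
      · subst hy; simp; positivity
      · rw [norm_smul, Real.norm_of_nonneg (by positivity), Real.norm_of_nonneg (by positivity),
          ← norm_mul_rpow_aux y ((n : ℝ) - s) hy, show (n : ℝ) - s + 1 = n + 1 - s by ring, mul_assoc]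
    · simp

lemma KK_meas (n : ℕ) (s R : ℝ) : StronglyMeasurable (KK n s R) := by
  unfold KK
  apply StronglyMeasurable.integral_prod_right
  apply Measurable.stronglyMeasurable
  unfold Function.uncurry
  exact (KKint_meas n s R).smul measurable_snd

lemma prod_integrable (n : ℕ) (hn : 1 ≤ n) (s : ℝ) (hs0 : 0 < s) (hs1 : s < 1) (u : EE n → ℝ)
    (hu : ContDiff ℝ (⊤ : ℕ∞) u) (huc : HasCompactSupport u) (x : EE n) (R : ℝ) :
    Integrable (Function.uncurry fun (z y : EE n) =>
      (if ‖y‖ < R then ‖z - y‖ ^ (-((n : ℝ) + s - 1)) * ‖y‖ ^ (-((n : ℝ) + 1 - s)) else 0) *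
        fderiv ℝ u (x - z) y) (volume.prod volume) := by
  have hn1 : (1:ℝ) ≤ n := by exact_mod_cast hn
  have h1 : Continuous (fderiv ℝ u) := hu.continuous_fderiv (by simp)
  obtain ⟨M, hM⟩ := h1.bounded_above_of_compact_support (huc.fderiv ℝ)
  obtain ⟨R0, hR0⟩ := (huc.fderiv ℝ).isCompact.isBounded.subset_ball (0 : EE n)
  have hM0 : 0 ≤ M := (norm_nonneg _).trans (hM 0)
  have hf := (integrable_indicator_iff measurableSet_ball).2 (int_ball n hn (n - s) R (by linarith))
  have hg := (integrable_indicator_iff measurableSet_ball).2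
    (int_ball n hn ((n:ℝ) + s - 1) (R + (R0 + ‖x‖)) (by linarith))
  have hfg := (Integrable.convolution_integrand (ContinuousLinearMap.mul ℝ ℝ) hf hg).const_mul M
  refine hfg.mono' ?_ ?_
  · apply Measurable.aestronglyMeasurable
    unfold Function.uncurry
    have : Measurable (fun q : EE n × EE n => fderiv ℝ u (x - q.1) q.2) := by
      have : Continuous (fun q : EE n × EE n => fderiv ℝ u (x - q.1) q.2) := by fun_prop
      exact this.measurable
    exact (KKint_meas n s R).mul this
  · refine Eventually.of_forall fun q => ?_
    obtain ⟨z, y⟩ := q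
    simp only [Function.uncurry, ContinuousLinearMap.mul_apply']
    have hnn : 0 ≤ M * ((Metric.ball (0 : EE n) R).indicator (fun w : EE n => ‖w‖ ^ (-((n : ℝ) - s))) y *
        (Metric.ball (0 : EE n) (R + (R0 + ‖x‖))).indicator (fun w : EE n => ‖w‖ ^ (-((n : ℝ) + s - 1))) (z - y)) := by
      refine mul_nonneg hM0 (mul_nonneg ?_ ?_) <;>
      · apply Set.indicator_nonneg; intro w _; positivity
    split_ifs with hy
    swap
    · simpa using hnn
    by_cases h0 : fderiv ℝ u (x - z) = 0
    · rw [h0]; simpa using hnn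
    have hxz : x - z ∈ Metric.ball (0 : EE n) R0 := hR0 (subset_tsupport _ h0)
    have hzy : z - y ∈ Metric.ball (0 : EE n) (R + (R0 + ‖x‖)) := by
      rw [mem_ball_zero_iff] at hxz ⊢
      have e1 := norm_sub_le z y
      have e2 : ‖z‖ ≤ ‖x‖ + ‖x - z‖ := by
        have := norm_sub_le x (x - z)
        rwa [_root_.sub_sub_cancel] at this
      linarith
    rw [Set.indicator_of_mem hzy, Set.indicator_of_mem (mem_ball_zero_iff.2 hy)]
    by_cases hy0 : y = 0
    · subst hy0; simp; positivity
    rw [norm_mul, Real.norm_of_nonneg (by positivity)]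
    have e3 := (fderiv ℝ u (x - z)).le_opNorm y
    have e4 : ‖fderiv ℝ u (x - z) y‖ ≤ M * ‖y‖ := e3.trans (by gcongr; exact hM _)
    calc _ ≤ ‖z - y‖ ^ (-((n : ℝ) + s - 1)) * ‖y‖ ^ (-((n : ℝ) + 1 - s)) * (M * ‖y‖) := by gcongr
      _ = _ := by
        rw [← norm_mul_rpow_aux y ((n : ℝ) - s) hy0, show (n : ℝ) - s + 1 = n + 1 - s by ring]; ring

lemma fubini_step (n : ℕ) (hn : 1 ≤ n) (s : ℝ) (hs0 : 0 < s) (hs1 : s < 1) (u : EE n → ℝ)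
    (hu : ContDiff ℝ (⊤ : ℕ∞) u) (huc : HasCompactSupport u) (x : EE n) (R : ℝ) :
    ∫ z, fderiv ℝ u (x - z) (KK n s R z) = ∫ y : EE n, ((n : ℝ) + s - 1) *
      ((if ‖y‖ < R then ‖y‖ ^ (-((n : ℝ) + 1 - s)) else 0) * inner ℝ y (JJ n s u (x - y))) := by
  have := EE_nontrivial n hn
  have hsw := integral_integral_swap (prod_integrable n hn s hs0 hs1 u hu huc x R)
  have hL : ∫ z, fderiv ℝ u (x - z) (KK n s R z) = ∫ z, ∫ y,
      (if ‖y‖ < R then ‖z - y‖ ^ (-((n : ℝ) + s - 1)) * ‖y‖ ^ (-((n : ℝ) + 1 - s)) else 0) *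
        fderiv ℝ u (x - z) y := by
    apply integral_congr_ae
    filter_upwards [Measure.ae_ne volume (0 : EE n)] with z hz
    unfold KK
    rw [← ContinuousLinearMap.integral_comp_comm _ (KK_integrand n hn s hs0 hs1 z hz R)]
    simp only [map_smul, smul_eq_mul]
  rw [hL, hsw]
  apply integral_congr_ae
  refine Eventually.of_forall fun y => ?_
  simp only
  have h := JJ_ibp n hn s hs0 hs1 u hu huc (x - y) y
  rw [mul_left_comm, h, ← integral_sub_right_eq_self (fun w => fderiv ℝ u (x - y - w) y * ‖w‖ ^ (-((n : ℝ) + s - 1))) y, ← integral_const_mul]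
  apply integral_congr_ae
  refine Eventually.of_forall fun z => ?_
  simp only 
  rw [show x - y - (z - y) = x - z by abel]
  split_ifs <;> ring

lemma limit_step (n : ℕ) (hn : 1 ≤ n) (s : ℝ) (hs0 : 0 < s) (hs1 : s < 1) (u : EE n → ℝ)
    (hu : ContDiff ℝ (⊤ : ℕ∞) u) (huc : HasCompactSupport u) (x e : EE n) (he : ‖e‖ = 1) :
    Tendsto (fun m : ℕ => ∫ z, fderiv ℝ u (x - z) (KK n s m z)) atTop
      (nhds ((∫ y, Phi n s e y) * ((volume : Measure (EE n)).toSphere.real Set.univ * u x))) := by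
  have := EE_nontrivial n hn
  have h1 : Continuous (fderiv ℝ u) := hu.continuous_fderiv (by simp)
  rw [← newton n hn u hu huc x, ← integral_const_mul]
  set κ := ∫ y, Phi n s e y with hκ
  have hne : ∀ᵐ z : EE n ∂volume, z ≠ 0 := Measure.ae_ne volume (0 : EE n)
  have hform : ∀ (m : ℕ) (z : EE n), z ≠ 0 → fderiv ℝ u (x - z) (KK n s m z) =
      hh n s e (m / ‖z‖) * (‖z‖ ^ (-(n : ℝ)) * fderiv ℝ u (x - z) z) := by
    intro m z hz
    rw [KK_formula n s m e he z hz, map_smul, smul_eq_mul, mul_assoc]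
  apply tendsto_integral_of_dominated_convergence
    (fun z => κ * (‖fderiv ℝ u (x - z)‖ * ‖z‖ ^ (-((n : ℝ) - 1))))
  · intro m
    have hc : Continuous (fun q : (EE n →L[ℝ] ℝ) × EE n => q.1 q.2) := by fun_prop
    have h2 : StronglyMeasurable (fun z => fderiv ℝ u (x - z)) := by
      have : Continuous (fun z => fderiv ℝ u (x - z)) := by fun_prop
      exact this.stronglyMeasurable
    exact (hc.comp_stronglyMeasurable (h2.prodMk (KK_meas n s m))).aestronglyMeasurable
  · exact (fderiv_int n hn u hu huc x).const_mul κ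
  · intro m
    filter_upwards [hne] with z hz
    rw [hform m z hz, norm_mul, norm_mul]
    rw [Real.norm_of_nonneg (by positivity : 0 ≤ ‖z‖ ^ (-(n : ℝ))), ← norm_mul_rpow_aux z ((n : ℝ) - 1) hz, sub_add_cancel]
    have h3 := (fderiv ℝ u (x - z)).le_opNorm z
    have h4 : ‖hh n s e (m / ‖z‖)‖ ≤ κ := hh_bounds n hn s hs0 hs1 e he _
    have h5 : 0 ≤ κ := (norm_nonneg _).trans h4
    calc _ ≤ κ * (‖z‖ ^ (-(n : ℝ)) * (‖fderiv ℝ u (x - z)‖ * ‖z‖)) := by gcongr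
      _ = _ := by ring
  · filter_upwards [hne] with z hz
    have hz0 : 0 < ‖z‖ := norm_pos_iff.2 hz
    simp only [hform _ z hz]
    apply Filter.Tendsto.mul_const
    exact (hh_tendsto n hn s hs0 hs1 e he).comp (tendsto_natCast_atTop_atTop.atTop_div_const hz0)

lemma enorm_step (n : ℕ) (hn : 1 ≤ n) (s : ℝ) (hs0 : 0 < s) (hs1 : s < 1) (u : EE n → ℝ)
    (hu : ContDiff ℝ (⊤ : ℕ∞) u) (huc : HasCompactSupport u) (x : EE n) (R : ℝ) :
    ‖∫ z, fderiv ℝ u (x - z) (KK n s R z)‖ₑ ≤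
      ENNReal.ofReal ((n : ℝ) + s - 1) * RP n s (fun y => ‖JJ n s u y‖ₑ) x := by
  have hn1 : (1:ℝ) ≤ n := by exact_mod_cast hn
  rw [fubini_step n hn s hs0 hs1 u hu huc x R, integral_const_mul, enorm_mul,
    Real.enorm_of_nonneg (by linarith : 0 ≤ (n : ℝ) + s - 1)]
  refine mul_le_mul_right ?_ _
  refine (enorm_integral_le_lintegral_enorm _).trans ?_
  unfold RP
  rw [← lintegral_sub_left_eq_self (fun y => ‖JJ n s u y‖ₑ * ENNReal.ofReal (‖x - y‖ ^ (s - (n : ℝ)))) x]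
  apply lintegral_mono
  intro y
  simp only [_root_.sub_sub_cancel]
  rw [← ofReal_norm, ← ofReal_norm, ← ENNReal.ofReal_mul (norm_nonneg _)]
  apply ENNReal.ofReal_le_ofReal
  by_cases hy : y = 0
  · subst hy; simp; positivity
  split_ifs
  · rw [norm_mul, Real.norm_of_nonneg (by positivity)]
    have := norm_inner_le_norm (𝕜 := ℝ) y (JJ n s u (x - y))
    calc _ ≤ ‖y‖ ^ (-((n : ℝ) + 1 - s)) * (‖y‖ * ‖JJ n s u (x - y)‖) := by gcongr
      _ = _ := by
        rw [show s - (n : ℝ) = -((n : ℝ) - s) by ring, ← norm_mul_rpow_aux y ((n : ℝ) - s) hy,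
          show (n : ℝ) - s + 1 = n + 1 - s by ring]
        ring
  · simp; positivity

lemma pointwise_bound (n : ℕ) (hn : 1 ≤ n) (s : ℝ) (hs0 : 0 < s) (hs1 : s < 1) :
    ∃ C : ℝ≥0∞, C ≠ ∞ ∧ ∀ u : EE n → ℝ, ContDiff ℝ (⊤ : ℕ∞) u → HasCompactSupport u → ∀ x,
      ‖u x‖ₑ ≤ C * RP n s (fun y => ‖JJ n s u y‖ₑ) x := by
  have := EE_nontrivial n hn
  obtain ⟨e, he⟩ := exists_norm_eq (EE n) (zero_le_one (α := ℝ))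
  set κ := ∫ y, Phi n s e y with hκ
  have hκ0 : 0 < κ := Phi_pos n hn s hs0 hs1 e he
  set σ := (volume : Measure (EE n)).toSphere.real Set.univ with hσ
  have hσ0 : 0 < σ := by
    rw [hσ, Measure.real, ENNReal.toReal_pos_iff]
    refine ⟨?_, measure_lt_top _ _⟩
    rw [pos_iff_ne_zero, Ne, Measure.measure_univ_eq_zero]
    exact Measure.toSphere_ne_zero _
  have hc0 : ENNReal.ofReal (κ * σ) ≠ 0 := by
    rw [Ne, ENNReal.ofReal_eq_zero, not_le]; positivity
  refine ⟨(ENNReal.ofReal (κ * σ))⁻¹ * ENNReal.ofReal ((n : ℝ) + s - 1),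
    ENNReal.mul_ne_top (ENNReal.inv_ne_top.2 hc0) ENNReal.ofReal_ne_top, ?_⟩
  intro u hu huc x
  have hlim := limit_step n hn s hs0 hs1 u hu huc x e he
  have h2 : ‖κ * (σ * u x)‖ₑ ≤ ENNReal.ofReal ((n : ℝ) + s - 1) * RP n s (fun y => ‖JJ n s u y‖ₑ) x := by
    refine le_of_tendsto ((continuous_enorm.tendsto _).comp hlim) (Eventually.of_forall fun m => ?_)
    exact enorm_step n hn s hs0 hs1 u hu huc x m
  rw [← mul_assoc, enorm_mul, Real.enorm_of_nonneg (by positivity : 0 ≤ κ * σ)] at h2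
  rw [mul_assoc, mul_comm _⁻¹, ← div_eq_mul_inv, ENNReal.le_div_iff_mul_le (Or.inl hc0) (Or.inl ENNReal.ofReal_ne_top), mul_comm]
  exact h2

lemma cns_pos (n : ℕ) (hn : 1 ≤ n) (s : ℝ) (hs0 : 0 < s) (hs1 : s < 1) : 0 < cns n s := by
  have hn1 : (1:ℝ) ≤ n := by exact_mod_cast hn
  have h1 : 0 < (n : ℝ) + s - 1 := by linarith
  have h2 := Real.Gamma_pos_of_pos (half_pos h1)
  have h3 := Real.Gamma_pos_of_pos (half_pos (sub_pos.2 hs1))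
  have h4 := Real.pi_pos
  unfold cns
  positivity

/-- Fractional Sobolev inequality: continuous embedding
`H^{s,p}(ℝⁿ) ↪ L^{p_s^*}(ℝⁿ)` in the subcritical case `sp < n`, with
`p_s^* = np/(n - sp)`. -/
theorem bessel_sobolev_inequality_subcritical
    (n : ℕ) (hn : 1 ≤ n) (s p : ℝ) (hs0 : 0 < s) (hs1 : s < 1)
    (hp : 1 < p) (hsp : s * p < n) :
    ∃ C : ℝ, 0 < C ∧ ∀ u : EuclideanSpace ℝ (Fin n) → ℝ,
      ContDiff ℝ (⊤ : ℕ∞) u → HasCompactSupport u →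
      eLpNorm u (ENNReal.ofReal (n * p / (n - s * p))) volume ≤
        ENNReal.ofReal C * (eLpNorm u (ENNReal.ofReal p) volume
          + eLpNorm (rieszGrad n s u) (ENNReal.ofReal p) volume) := by
  obtain ⟨C1, hC1, hpt⟩ := pointwise_bound n hn s hs0 hs1
  obtain ⟨C2, hC2, hls⟩ := HLS n hn s p hs0 hp hsp
  have hc := cns_pos n hn s hs0 hs1
  have hce : ‖cns n s‖ₑ ≠ 0 := by simpa using hc.ne'
  have hct : ‖cns n s‖ₑ ≠ ∞ := enorm_ne_top
  set K : ℝ≥0∞ := C1 * C2 * ‖cns n s‖ₑ⁻¹ with hK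
  have hKt : K ≠ ∞ := ENNReal.mul_ne_top (ENNReal.mul_ne_top hC1 hC2) (ENNReal.inv_ne_top.2 hce)
  refine ⟨K.toReal + 1, by positivity, ?_⟩
  intro u hu huc
  have hCK : K ≤ ENNReal.ofReal (K.toReal + 1) := by
    rw [← ENNReal.ofReal_toReal hKt]
    apply ENNReal.ofReal_le_ofReal
    rw [ENNReal.toReal_ofReal toReal_nonneg]; linarith
  have hgrad : eLpNorm (rieszGrad n s u) (ENNReal.ofReal p) volume
      = ‖cns n s‖ₑ * eLpNorm (JJ n s u) (ENNReal.ofReal p) volume := by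
    rw [← eLpNorm_const_smul]; rfl
  by_cases hinf : eLpNorm (JJ n s u) (ENNReal.ofReal p) volume = ∞
  · rw [hgrad, hinf, ENNReal.mul_top hce, add_top, ENNReal.mul_top]
    · exact le_top
    · rw [Ne, ENNReal.ofReal_eq_zero, not_le]; positivity
  have hp0 : 0 < p := by linarith
  have hn1 : (1:ℝ) ≤ n := by exact_mod_cast hn
  have hq0 : 0 < n * p / (n - s * p) := div_pos (by positivity) (by linarith)
  have hJ : eLpNorm (JJ n s u) (ENNReal.ofReal p) volume = (∫⁻ y, ‖JJ n s u y‖ₑ ^ p) ^ (1 / p) := by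
    rw [eLpNorm_eq_lintegral_rpow_enorm_toReal (by simpa using hp0) ENNReal.ofReal_ne_top, ENNReal.toReal_ofReal hp0.le]
  have hfin : ∫⁻ y, ‖JJ n s u y‖ₑ ^ p ≠ ∞ := by
    intro h
    rw [hJ, h, ENNReal.top_rpow_of_pos (by positivity)] at hinf
    exact hinf rfl
  have h1 := hls (fun y => ‖JJ n s u y‖ₑ) (JJ_meas n s u hu.continuous).measurable.enorm
    (fun x => enorm_ne_top) hfin
  rw [← hJ] at h1
  have h2 : eLpNorm u (ENNReal.ofReal (n * p / (n - s * p))) volume ≤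
      C1 * (C2 * eLpNorm (JJ n s u) (ENNReal.ofReal p) volume) := by
    refine le_trans ?_ (mul_le_mul_right h1 C1)
    rw [eLpNorm_eq_lintegral_rpow_enorm_toReal (by simpa using hq0) ENNReal.ofReal_ne_top, ENNReal.toReal_ofReal hq0.le]
    set q := n * p / (n - s * p) with hq
    calc (∫⁻ x, ‖u x‖ₑ ^ q) ^ (1 / q)
        ≤ (∫⁻ x, C1 ^ q * RP n s (fun y => ‖JJ n s u y‖ₑ) x ^ q) ^ (1 / q) := by
          refine ENNReal.rpow_le_rpow (lintegral_mono fun x => ?_) (by positivity)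
          rw [← ENNReal.mul_rpow_of_nonneg _ _ hq0.le]
          exact ENNReal.rpow_le_rpow (hpt u hu huc x) hq0.le
      _ = _ := by
          rw [lintegral_const_mul' _ _ (ENNReal.rpow_ne_top_of_nonneg hq0.le hC1),
            ENNReal.mul_rpow_of_nonneg _ _ (by positivity), ← ENNReal.rpow_mul,
            mul_one_div_cancel hq0.ne', ENNReal.rpow_one]
  refine h2.trans ?_
  calc C1 * (C2 * eLpNorm (JJ n s u) (ENNReal.ofReal p) volume)
      = K * eLpNorm (rieszGrad n s u) (ENNReal.ofReal p) volume := by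
        rw [hgrad, hK, mul_assoc (C1 * C2), ← mul_assoc (‖cns n s‖ₑ⁻¹), ENNReal.inv_mul_cancel hce hct,
          one_mul, mul_assoc]
    _ ≤ _ := mul_le_mul' hCK le_add_self

end
end

section
/- Let n ≥ 1 and let e₁ denote the first vector of the canonical basis of ℝⁿ. There exists a constant C > 0, depending only on n and not on s, such that for every s ∈ (0,1), ∫_{ℝⁿ} | x/|x|^{n+1−s} − (x − e₁)/|x − e₁|^{n+1−s} | dx ≤ C / (s(1−s)). -/
open MeasureTheory Filter ENNReal

noncomputable section

/-- Near-field radial majorant. -/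
def nearF (n : ℕ) (s : ℝ) : ℝ → ℝ := (Set.Ioc (0:ℝ) 3).indicator (fun y => y ^ (s - n))

/-- Far-field radial majorant. -/
def farF (n : ℕ) (s : ℝ) : ℝ → ℝ := (Set.Ioi (1:ℝ)).indicator (fun y => y ^ (s - n - 1))

lemma nearF_nonneg (n : ℕ) (s y : ℝ) : 0 ≤ nearF n s y :=
  Set.indicator_nonneg (fun _ hx => Real.rpow_nonneg hx.1.le _) y

lemma farF_nonneg (n : ℕ) (s y : ℝ) : 0 ≤ farF n s y :=
  Set.indicator_nonneg (fun _ hx => Real.rpow_nonneg (zero_le_one.trans (le_of_lt hx)) _) y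

lemma pow_mul_rpow_aux (n : ℕ) (hn : 1 ≤ n) (y a : ℝ) (hy : 0 < y) :
    y ^ (n - 1) * y ^ a = y ^ (n - 1 + a) := by
  rw [Real.rpow_add hy, ← Real.rpow_natCast, Nat.cast_sub hn, Nat.cast_one]

lemma near_eq (n : ℕ) (hn : 1 ≤ n) (s : ℝ) :
    (fun y : ℝ => y ^ (n - 1) • nearF n s y) =
      (Set.Ioc (0:ℝ) 3).indicator (fun y => y ^ (s - 1)) := by
  ext y
  by_cases hy : y ∈ Set.Ioc (0:ℝ) 3
  · simp only [nearF, Set.indicator_of_mem hy, smul_eq_mul]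
    rw [pow_mul_rpow_aux n hn y _ hy.1]; congr 1; ring
  · simp [nearF, Set.indicator_of_notMem hy]

lemma far_eq (n : ℕ) (hn : 1 ≤ n) (s : ℝ) :
    (fun y : ℝ => y ^ (n - 1) • farF n s y) =
      (Set.Ioi (1:ℝ)).indicator (fun y => y ^ (s - 2)) := by
  ext y
  by_cases hy : y ∈ Set.Ioi (1:ℝ)
  · simp only [farF, Set.indicator_of_mem hy, smul_eq_mul]
    rw [pow_mul_rpow_aux n hn y _ (zero_lt_one.trans hy)]; congr 1; ring
  · simp [farF, Set.indicator_of_notMem hy]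

lemma radial_lintegral (n : ℕ) (hn : 1 ≤ n) (f : ℝ → ℝ) (hf : ∀ y, 0 ≤ f y)
    (hi : IntegrableOn (fun y : ℝ => y ^ (n - 1) • f y) (Set.Ioi 0)) :
    ∫⁻ x : EuclideanSpace ℝ (Fin n), ENNReal.ofReal (f ‖x‖) =
      ENNReal.ofReal (n * volume.real (Metric.ball (0 : EuclideanSpace ℝ (Fin n)) 1) *
        ∫ y in Set.Ioi (0:ℝ), y ^ (n - 1) • f y) := by
  have : Nonempty (Fin n) := ⟨⟨0, hn⟩⟩
  have hd : Module.finrank ℝ (EuclideanSpace ℝ (Fin n)) = n := by simp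
  rw [← ofReal_integral_eq_lintegral_ofReal, integral_fun_norm_addHaar, hd]
  · simp only [nsmul_eq_mul, smul_eq_mul, mul_assoc]
  · rw [integrable_fun_norm_addHaar, hd]; exact hi
  · exact Eventually.of_forall fun x => hf _

lemma near_lintegral (n : ℕ) (hn : 1 ≤ n) (s : ℝ) (hs : 0 < s) (hs1 : s < 1) :
    ∫⁻ x : EuclideanSpace ℝ (Fin n), ENNReal.ofReal (nearF n s ‖x‖) ≤
      ENNReal.ofReal (n * volume.real (Metric.ball (0 : EuclideanSpace ℝ (Fin n)) 1) *
        (3 / s)) := by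
  have hI : IntegrableOn (fun y : ℝ => y ^ (s - 1)) (Set.Ioc 0 3) := by
    have := (intervalIntegral.intervalIntegrable_rpow' (a := 0) (b := 3)
      (show -1 < s - 1 by linarith))
    exact (intervalIntegrable_iff_integrableOn_Ioc_of_le (by norm_num)).1 this
  rw [radial_lintegral n hn _ (nearF_nonneg n s)]
  · apply ENNReal.ofReal_le_ofReal
    gcongr
    rw [near_eq n hn, setIntegral_indicator measurableSet_Ioc,
      Set.inter_eq_right.2 Set.Ioc_subset_Ioi_self,
      ← intervalIntegral.integral_of_le (by norm_num), integral_rpow (Or.inl (by linarith))]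
    rw [sub_add_cancel, Real.zero_rpow hs.ne', sub_zero]
    gcongr
    calc (3:ℝ) ^ s ≤ 3 ^ (1:ℝ) := Real.rpow_le_rpow_of_exponent_le (by norm_num) hs1.le
      _ = 3 := Real.rpow_one _
  · rw [near_eq n hn]
    exact (hI.integrable_indicator measurableSet_Ioc).integrableOn

lemma far_lintegral (n : ℕ) (hn : 1 ≤ n) (s : ℝ) (hs1 : s < 1) :
    ∫⁻ x : EuclideanSpace ℝ (Fin n), ENNReal.ofReal (farF n s ‖x‖) ≤
      ENNReal.ofReal (n * volume.real (Metric.ball (0 : EuclideanSpace ℝ (Fin n)) 1) *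
        (1 / (1 - s))) := by
  have hI : IntegrableOn (fun y : ℝ => y ^ (s - 2)) (Set.Ioi 1) :=
    integrableOn_Ioi_rpow_of_lt (by linarith) one_pos
  rw [radial_lintegral n hn _ (farF_nonneg n s)]
  · apply ENNReal.ofReal_le_ofReal
    gcongr
    rw [far_eq n hn, setIntegral_indicator measurableSet_Ioi,
      Set.inter_eq_right.2 (Set.Ioi_subset_Ioi zero_le_one),
      integral_Ioi_rpow_of_lt (by linarith) one_pos, Real.one_rpow]
    apply le_of_eq
    rw [neg_div, ← div_neg]
    congr 1; ring
  · rw [far_eq n hn]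
    exact (hI.integrable_indicator measurableSet_Ioi).integrableOn

lemma rpow_diff (p m a b : ℝ) (hp : 0 < p) (hm : 0 < m) (ha : m ≤ a) (hb : m ≤ b) :
    |a ^ (-p) - b ^ (-p)| ≤ p * m ^ (-p - 1) * |a - b| := by
  have := Convex.norm_image_sub_le_of_norm_hasDerivWithin_le (s := Set.Ici m)
    (f := fun x : ℝ => x ^ (-p)) (f' := fun x => (-p) * x ^ (-p - 1)) (x := b) (y := a)
    (C := p * m ^ (-p - 1)) ?_ ?_ (convex_Ici m) hb ha
  · simpa using this
  · intro x hx
    exact (Real.hasDerivAt_rpow_const (Or.inl (hm.trans_le hx).ne')).hasDerivWithinAt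
  · intro x hx
    have hx0 : 0 < x := hm.trans_le hx
    rw [norm_mul, norm_neg, Real.norm_of_nonneg hp.le,
      Real.norm_of_nonneg (Real.rpow_nonneg hx0.le _)]
    have hz : -p - 1 ≤ 0 := by linarith
    exact mul_le_mul_of_nonneg_left (Real.rpow_le_rpow_of_nonpos hm hx hz) hp.le

lemma kernel_far {E : Type*} [NormedAddCommGroup E] [NormedSpace ℝ E] (N p : ℝ) (hp : 0 < p)
    (hpN : p ≤ N) (x e : E) (he : ‖e‖ = 1) (hx : 2 < ‖x‖) :
    ‖(‖x‖ ^ p)⁻¹ • x - (‖x - e‖ ^ p)⁻¹ • (x - e)‖ ≤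
      (1 + N * 2 ^ (N + 1) * (3 / 2)) * ‖x‖ ^ (-p) := by
  have h1 : ‖x‖ / 2 ≤ ‖x - e‖ := by
    have := norm_sub_norm_le x e
    linarith
  have h2 : ‖x - e‖ ≤ 3 / 2 * ‖x‖ := by
    have := norm_sub_le x e
    linarith
  have h3 : |‖x‖ - ‖x - e‖| ≤ 1 := by
    have := abs_norm_sub_norm_le x (x - e)
    simpa [he] using this
  have hx0 : 0 < ‖x‖ := by linarith
  rw [← Real.rpow_neg hx0.le, ← Real.rpow_neg (norm_nonneg _)]
  have key : ‖x‖ ^ (-p) • x - ‖x - e‖ ^ (-p) • (x - e) =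
      ‖x‖ ^ (-p) • e + (‖x‖ ^ (-p) - ‖x - e‖ ^ (-p)) • (x - e) := by
    module
  have hd := rpow_diff p (‖x‖ / 2) ‖x‖ ‖x - e‖ hp (by linarith) (by linarith) h1
  have hpow : (‖x‖ / 2) ^ (-p - 1) = ‖x‖ ^ (-p) * ‖x‖⁻¹ * 2 ^ (p + 1) := by
    rw [Real.div_rpow hx0.le (by norm_num), Real.rpow_sub hx0, Real.rpow_one,
      show -p - 1 = -(p + 1) by ring, Real.rpow_neg (by norm_num : (0:ℝ) ≤ 2), div_inv_eq_mul]
    rfl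
  have hA : 0 ≤ ‖x‖ ^ (-p) := Real.rpow_nonneg hx0.le _
  have h2p : (2:ℝ) ^ (p + 1) ≤ 2 ^ (N + 1) :=
    Real.rpow_le_rpow_of_exponent_le (by norm_num) (by linarith)
  rw [key]
  calc _ ≤ ‖‖x‖ ^ (-p) • e‖ + ‖(‖x‖ ^ (-p) - ‖x - e‖ ^ (-p)) • (x - e)‖ := norm_add_le _ _
    _ = ‖x‖ ^ (-p) + |‖x‖ ^ (-p) - ‖x - e‖ ^ (-p)| * ‖x - e‖ := by
      rw [norm_smul, norm_smul, he, mul_one, Real.norm_of_nonneg hA, Real.norm_eq_abs]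
    _ ≤ ‖x‖ ^ (-p) + (p * (‖x‖ / 2) ^ (-p - 1) * 1) * (3 / 2 * ‖x‖) := by
      gcongr
      refine hd.trans ?_
      gcongr
    _ = (1 + p * 2 ^ (p + 1) * (3 / 2)) * ‖x‖ ^ (-p) := by
      rw [hpow]; field_simp
    _ ≤ _ := by
      have hN0 : 0 ≤ N := by linarith
      gcongr

lemma kernel_near {E : Type*} [NormedAddCommGroup E] [NormedSpace ℝ E] (n : ℕ) (s : ℝ)
    (x : E) (hx : ‖x‖ ≤ 3) :
    ‖(‖x‖ ^ ((n : ℝ) + 1 - s))⁻¹ • x‖ ≤ nearF n s ‖x‖ := by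
  rcases eq_or_ne x 0 with rfl | h0
  · simpa using nearF_nonneg n s 0
  · have hp : 0 < ‖x‖ := norm_pos_iff.2 h0
    rw [nearF, Set.indicator_of_mem (show ‖x‖ ∈ Set.Ioc (0:ℝ) 3 from ⟨hp, hx⟩), norm_smul,
      ← Real.rpow_neg hp.le, Real.norm_of_nonneg (Real.rpow_nonneg hp.le _)]
    nth_rewrite 2 [← Real.rpow_one ‖x‖]
    rw [← Real.rpow_add hp]
    apply le_of_eq; congr 1; ring

lemma kernel_bound {E : Type*} [NormedAddCommGroup E] [NormedSpace ℝ E] (n : ℕ) (s : ℝ)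
    (hs : 0 < s) (hs1 : s < 1) (x e : E) (he : ‖e‖ = 1) :
    ‖(‖x‖ ^ ((n : ℝ) + 1 - s))⁻¹ • x - (‖x - e‖ ^ ((n : ℝ) + 1 - s))⁻¹ • (x - e)‖ ≤
      nearF n s ‖x‖ + nearF n s ‖x - e‖ +
        (1 + ((n:ℝ) + 1) * 2 ^ ((n:ℝ) + 1 + 1) * (3 / 2)) * farF n s ‖x‖ := by
  have hn0 : (0:ℝ) ≤ n := Nat.cast_nonneg n
  have hM : 0 ≤ (1 + ((n:ℝ) + 1) * 2 ^ ((n:ℝ) + 1 + 1) * (3 / 2)) := by positivity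
  have f0 := mul_nonneg hM (farF_nonneg n s ‖x‖)
  have a0 := nearF_nonneg n s ‖x‖
  have b0 := nearF_nonneg n s ‖x - e‖
  rcases le_or_gt ‖x‖ 2 with h | h
  · have h3 : ‖x - e‖ ≤ 3 := by
      have := norm_sub_le x e
      linarith
    have := kernel_near n s x (by linarith)
    have := kernel_near n s (x - e) h3
    refine (norm_sub_le _ _).trans ?_
    linarith
  · have := kernel_far ((n:ℝ) + 1) ((n : ℝ) + 1 - s) (by linarith) (by linarith) x e he h
    have hf : farF n s ‖x‖ = ‖x‖ ^ (-((n : ℝ) + 1 - s)) := by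
      rw [farF, Set.indicator_of_mem (show ‖x‖ ∈ Set.Ioi (1:ℝ) from by
        simp only [Set.mem_Ioi]; linarith)]
      congr 1; ring
    rw [hf]
    linarith

lemma nearF_measurable (n : ℕ) (s : ℝ) : Measurable (nearF n s) :=
  Measurable.indicator (by fun_prop) measurableSet_Ioc

/-- Uniform-in-`s` kernel difference estimate:
`∫ |x/|x|^{n+1-s} - (x-e₁)/|x-e₁|^{n+1-s}| dx ≤ C/(s(1-s))` with `C` independent of `s`. -/
theorem kernel_translation_estimate
    (n : ℕ) (hn : 1 ≤ n) :
    ∃ C : ℝ, 0 < C ∧ ∀ s : ℝ, 0 < s → s < 1 →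
      (∫⁻ x : EuclideanSpace ℝ (Fin n),
        ENNReal.ofReal ‖(‖x‖ ^ ((n : ℝ) + 1 - s))⁻¹ • x -
          (‖x - EuclideanSpace.single (⟨0, hn⟩ : Fin n) (1 : ℝ)‖ ^ ((n : ℝ) + 1 - s))⁻¹ •
            (x - EuclideanSpace.single (⟨0, hn⟩ : Fin n) (1 : ℝ))‖)
        ≤ ENNReal.ofReal (C / (s * (1 - s))) := by
  set V : ℝ := n * volume.real (Metric.ball (0 : EuclideanSpace ℝ (Fin n)) 1) with hV
  have hV0 : 0 ≤ V := by positivity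
  set M : ℝ := 1 + ((n:ℝ) + 1) * 2 ^ ((n:ℝ) + 1 + 1) * (3 / 2) with hMdef
  have hM : 0 ≤ M := by positivity
  refine ⟨V * (6 + M) + 1, by positivity, fun s hs hs1 => ?_⟩
  have hs' : 0 < 1 - s := by linarith
  set e : EuclideanSpace ℝ (Fin n) := EuclideanSpace.single (⟨0, hn⟩ : Fin n) (1 : ℝ) with hedef
  have he : ‖e‖ = 1 := by simp [hedef]
  have hN := near_lintegral n hn s hs hs1
  have hF := far_lintegral n hn s hs1
  rw [← hV] at hN hF
  have hmeas : Measurable fun x : EuclideanSpace ℝ (Fin n) => ENNReal.ofReal (nearF n s ‖x‖) :=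
    ((nearF_measurable n s).comp measurable_norm).ennreal_ofReal
  have hmeas2 : Measurable fun x : EuclideanSpace ℝ (Fin n) =>
      ENNReal.ofReal (nearF n s ‖x - e‖) :=
    hmeas.comp (measurable_id.sub_const e)
  have htrans : ∫⁻ x : EuclideanSpace ℝ (Fin n), ENNReal.ofReal (nearF n s ‖x - e‖) =
      ∫⁻ x : EuclideanSpace ℝ (Fin n), ENNReal.ofReal (nearF n s ‖x‖) :=
    lintegral_sub_right_eq_self (fun x : EuclideanSpace ℝ (Fin n) =>
      ENNReal.ofReal (nearF n s ‖x‖)) e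
  calc _ ≤ ∫⁻ x : EuclideanSpace ℝ (Fin n), (ENNReal.ofReal (nearF n s ‖x‖) +
        ENNReal.ofReal (nearF n s ‖x - e‖) +
        ENNReal.ofReal M * ENNReal.ofReal (farF n s ‖x‖)) := by
        apply lintegral_mono
        intro x
        have a0 := nearF_nonneg n s ‖x‖
        have b0 := nearF_nonneg n s ‖x - e‖
        have c0 := farF_nonneg n s ‖x‖
        simp only
        rw [← ENNReal.ofReal_mul hM, ← ENNReal.ofReal_add a0 b0,
          ← ENNReal.ofReal_add (add_nonneg a0 b0) (mul_nonneg hM c0)]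
        exact ENNReal.ofReal_le_ofReal (kernel_bound n s hs hs1 x e he)
    _ = (∫⁻ x : EuclideanSpace ℝ (Fin n), ENNReal.ofReal (nearF n s ‖x‖)) +
        (∫⁻ x : EuclideanSpace ℝ (Fin n), ENNReal.ofReal (nearF n s ‖x‖)) +
        ENNReal.ofReal M * ∫⁻ x : EuclideanSpace ℝ (Fin n), ENNReal.ofReal (farF n s ‖x‖) := by
        rw [lintegral_add_left (by fun_prop), lintegral_add_left hmeas, htrans,
          lintegral_const_mul' _ _ ENNReal.ofReal_ne_top]
    _ ≤ ENNReal.ofReal (V * (3 / s)) + ENNReal.ofReal (V * (3 / s)) +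
        ENNReal.ofReal M * ENNReal.ofReal (V * (1 / (1 - s))) := by gcongr
    _ = ENNReal.ofReal (V * (3 / s) + V * (3 / s) + M * (V * (1 / (1 - s)))) := by
        rw [← ENNReal.ofReal_mul hM, ← ENNReal.ofReal_add (by positivity) (by positivity),
          ← ENNReal.ofReal_add (by positivity) (by positivity)]
    _ ≤ _ := by
        apply ENNReal.ofReal_le_ofReal
        rw [le_div_iff₀ (by positivity)]
        have : (V * (3 / s) + V * (3 / s) + M * (V * (1 / (1 - s)))) * (s * (1 - s)) =
            V * 6 * (1 - s) + M * V * s := by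
          field_simp; ring
        rw [this]
        nlinarith [mul_nonneg hV0 hs.le, mul_nonneg (mul_nonneg hM hV0) hs'.le]

end
end
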